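/- arXiv:math/0407363 — 5 statements merged into one kernel-verified Lean document; each statement's English description precedes it below -/
import Mathlib

section
/- Let n > 1 be an integer and let x, y be real numbers with x ≠ y. Then Σ_{k=1}^{n-1} B_k(x) B_{n-k}(y) / (k(n-k)) − Σ_{l=1}^{n} C(n-1, l-1) · (B_l(x-y) B_{n-l}(y) + B_l(y-x) B_{n-l}(x)) / l² = (H_{n-1}/n) · (B_n(x) + B_n(y)) + (B_n(x) − B_n(y)) / (n(x−y)). -/
open Finset

/-- The `n`-th Bernoulli polynomial evaluated at a real `x`:
`B_n(x) = ∑_{k=0}^n (n choose k) B_k x^(n-k)`, where `B_k` is the `k`-th Bernoulli number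
(with the convention `B_1 = -1/2`, i.e. generating function `z e^{xz}/(e^z - 1)`). -/
noncomputable def bernoulliPoly (n : ℕ) (x : ℝ) : ℝ :=
  ∑ k ∈ Finset.range (n + 1), ((bernoulli k : ℚ) : ℝ) * (n.choose k : ℝ) * x ^ (n - k)

/-- The `n`-th harmonic number `H_n = ∑_{k=1}^n 1/k` as a real number. -/
noncomputable def harm (n : ℕ) : ℝ :=
  ∑ k ∈ Finset.range n, (1 : ℝ) / (k + 1)

lemma b_eq (n : ℕ) (x : ℝ) : bernoulliPoly n x = Polynomial.aeval x (Polynomial.bernoulli n) := by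
  simp only [bernoulliPoly, Polynomial.bernoulli_def, map_sum, Polynomial.aeval_monomial]
  rw [← Finset.sum_range_reflect]
  apply Finset.sum_congr rfl
  intro k hk
  have hk' : k ≤ n := by simpa [Nat.lt_succ_iff] using hk
  have h1 : n + 1 - 1 - k = n - k := by omega
  have h2 : n - (n - k) = k := by omega
  rw [h1, h2, Nat.choose_symm hk']
  simp

lemma b_deriv (k : ℕ) (x : ℝ) :
    HasDerivAt (bernoulliPoly (k+1)) (((k:ℝ)+1) * bernoulliPoly k x) x := by
  have h : bernoulliPoly (k+1) = fun x => Polynomial.aeval x (Polynomial.bernoulli (k+1)) := by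
    funext x; exact b_eq _ x
  rw [h, b_eq]
  have := (Polynomial.bernoulli (k+1)).hasDerivAt_aeval x
  rw [Polynomial.derivative_bernoulli_add_one] at this
  simpa using this

lemma b_zero (x : ℝ) : bernoulliPoly 0 x = 1 := by simp [bernoulliPoly]

lemma b_one_add (n : ℕ) (x : ℝ) :
    bernoulliPoly (n+1) (1 + x) = bernoulliPoly (n+1) x + ((n:ℝ)+1) * x ^ n := by
  have h := congrArg (Polynomial.aeval x) (Polynomial.bernoulli_comp_one_add_X (n+1))
  rw [Polynomial.aeval_comp] at h
  rw [b_eq, b_eq]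
  simpa using h

/-- Appell-type sum. -/
noncomputable def UU (n : ℕ) (a : ℕ → ℝ) (y : ℝ) : ℝ :=
  ∑ l ∈ Finset.range (n+1), (n.choose l : ℝ) * a l * bernoulliPoly (n - l) y

lemma UU_deriv (n : ℕ) (a : ℕ → ℝ) (y : ℝ) :
    HasDerivAt (UU (n+1) a) (((n:ℝ)+1) * UU n a y) y := by
  have h : UU (n+1) a = fun y => (∑ l ∈ Finset.range (n+1),
      ((n+1).choose l : ℝ) * a l * bernoulliPoly (n - l + 1) y) + a (n+1) := by
    funext y
    rw [UU, Finset.sum_range_succ]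
    congr 1
    · apply Finset.sum_congr rfl
      intro l hl
      have : n + 1 - l = n - l + 1 := by have := Finset.mem_range.1 hl; omega
      rw [this]
    · simp [b_zero]
  rw [h, UU, Finset.mul_sum]
  apply HasDerivAt.add_const
  apply HasDerivAt.fun_sum
  intro l hl
  have hl' : l ≤ n := by have := Finset.mem_range.1 hl; omega
  have h1 := (b_deriv (n - l) y).const_mul (((n+1).choose l : ℝ) * a l)
  refine h1.congr_deriv ?_
  have h2 := Nat.choose_mul_succ_eq n l
  have h3 : n + 1 - l = (n - l) + 1 := by omega
  rw [h3] at h2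
  have h4 : (n.choose l : ℝ) * ((n:ℝ) + 1) = ((n+1).choose l : ℝ) * (((n - l : ℕ) : ℝ) + 1) := by
    exact_mod_cast h2
  linear_combination (-(a l * bernoulliPoly (n-l) y)) * h4

lemma const_of_deriv {f : ℝ → ℝ} (h : ∀ x, HasDerivAt f 0 x) (x y : ℝ) : f x = f y :=
  is_const_of_deriv_eq_zero (fun x => (h x).differentiableAt) (fun x => (h x).deriv) x y

lemma b_add (a : ℝ) (n : ℕ) (y : ℝ) : bernoulliPoly n (a + y) = UU n (fun l => a ^ l) y := by
  induction n generalizing y with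
  | zero => simp [UU, b_zero]
  | succ n ih =>
    have h : ∀ z, HasDerivAt (fun z => bernoulliPoly (n+1) (a + z) - UU (n+1) (fun l => a^l) z) 0 z := by
      intro z
      have h1 := (b_deriv n (a+z)).comp_const_add a z
      have h2 := h1.sub (UU_deriv n (fun l => a^l) z)
      rw [ih z, sub_self] at h2
      exact h2
    have h0 := const_of_deriv h y 0
    have h1 : bernoulliPoly (n+1) (a+0) = UU (n+1) (fun l => a^l) 0 := by
      rw [add_zero, bernoulliPoly, UU, ← Finset.sum_range_reflect]
      apply Finset.sum_congr rfl
      intro k hk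
      have hk' : k ≤ n + 1 := by have := Finset.mem_range.1 hk; omega
      have e1 : n + 1 + 1 - 1 - k = n + 1 - k := by omega
      have e2 : n + 1 - (n + 1 - k) = k := by omega
      rw [e1, e2, Nat.choose_symm hk', b_eq]
      have : (Polynomial.aeval (0:ℝ)) (Polynomial.bernoulli (n+1-k)) = ((bernoulli (n+1-k) : ℚ) : ℝ) := by
        rw [← Polynomial.bernoulli_eval_zero, ← map_zero (algebraMap ℚ ℝ),
          Polynomial.aeval_algebraMap_apply]
        simp
      rw [this]; ring
    linarith

/-- Polynomial form of the divided difference. -/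
noncomputable def QQ (n : ℕ) (x y : ℝ) : ℝ := UU n (fun l => (x-y)^l/((l:ℝ)+1)) y

lemma QQ_mul (n : ℕ) (x y : ℝ) :
    ((n:ℝ)+1) * (x-y) * QQ n x y = bernoulliPoly (n+1) x - bernoulliPoly (n+1) y := by
  have h := b_add (x-y) (n+1) y
  rw [sub_add_cancel, UU, Finset.sum_range_succ'] at h
  simp only [Nat.choose_zero_right, pow_zero, Nat.sub_zero, Nat.cast_one, one_mul] at h
  rw [h, add_sub_cancel_right, QQ, UU, Finset.mul_sum]
  apply Finset.sum_congr rfl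
  intro l hl
  have e : n + 1 - (l+1) = n - l := by omega
  have h4 : ((n:ℝ) + 1) * (n.choose l : ℝ) = ((n+1).choose (l+1) : ℝ) * ((l : ℝ) + 1) := by
    exact_mod_cast Nat.add_one_mul_choose_eq n l
  have h5 : (l:ℝ) + 1 ≠ 0 := by positivity
  rw [e]
  field_simp
  linear_combination (x-y)^(l+1) * bernoulliPoly (n-l) y * h4

lemma QQ_symm (n : ℕ) (x y : ℝ) : QQ n x y = QQ n y x := by
  by_cases hxy : x = y
  · rw [hxy]
  have h1 := QQ_mul n x y
  have h2 := QQ_mul n y x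
  have h3 : x - y ≠ 0 := sub_ne_zero.2 hxy
  have h4 : (n:ℝ)+1 ≠ 0 := by positivity
  apply mul_left_cancel₀ (mul_ne_zero h4 h3)
  linear_combination h1 + h2

/-- Convolution sum. -/
noncomputable def SS (n : ℕ) (x y : ℝ) : ℝ :=
  ∑ k ∈ Finset.range n, bernoulliPoly (k+1) x * bernoulliPoly (n-k) y / (((k:ℝ)+1) * ((n:ℝ)-k))

lemma SS_symm (n : ℕ) (x y : ℝ) : SS n x y = SS n y x := by
  rw [SS, SS, ← Finset.sum_range_reflect]
  apply Finset.sum_congr rfl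
  intro k hk
  have hk := Finset.mem_range.1 hk
  have e1 : n - 1 - k + 1 = n - k := by omega
  have e2 : n - (n - 1 - k) = k + 1 := by omega
  have e3 : ((n - 1 - k : ℕ) : ℝ) = n - 1 - k := by
    rw [Nat.cast_sub (by omega), Nat.cast_sub (by omega)]; simp
  rw [e1, e2, e3]
  congr 1 <;> ring

lemma SS_deriv (n : ℕ) (d y : ℝ) :
    HasDerivAt (fun y => SS (n+1) (y+d) y) (((n:ℝ)+1) * SS n (y+d) y
      + (bernoulliPoly (n+1) (y+d) + bernoulliPoly (n+1) y)/((n:ℝ)+1)) y := by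
  have h : HasDerivAt (fun y => SS (n+1) (y+d) y)
      (∑ k ∈ Finset.range (n+1), (bernoulliPoly k (y+d) * bernoulliPoly (n+1-k) y / ((n:ℝ)+1-k)
        + bernoulliPoly (k+1) (y+d) * bernoulliPoly (n-k) y / ((k:ℝ)+1))) y := by
    unfold SS
    apply HasDerivAt.fun_sum
    intro k hk
    have hk := Finset.mem_range.1 hk
    have e1 : n + 1 - k = n - k + 1 := by omega
    have e2 : ((n - k : ℕ) : ℝ) = n - k := by rw [Nat.cast_sub (by omega)]
    have e3 : (k:ℝ) < n + 1 := by exact_mod_cast hk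
    have h1 := (b_deriv k (y+d)).comp_add_const y d
    have h2 := b_deriv (n-k) y
    rw [e1]
    refine ((h1.fun_mul h2).div_const (((k:ℝ)+1) * (((n+1:ℕ):ℝ)-k))).congr_deriv ?_
    rw [e2]
    have e4 : (n:ℝ) + 1 - k ≠ 0 := by linarith
    have e5 : (k:ℝ) + 1 ≠ 0 := by positivity
    push_cast
    field_simp
    ring
  refine h.congr_deriv ?_
  symm
  rw [Finset.sum_add_distrib, Finset.sum_range_succ', Finset.sum_range_succ, SS, Finset.mul_sum]
  have : ∑ k ∈ Finset.range n, ((n:ℝ)+1) * (bernoulliPoly (k+1) (y+d) * bernoulliPoly (n-k) y / (((k:ℝ)+1) * ((n:ℝ)-k)))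
     = ∑ k ∈ Finset.range n, bernoulliPoly (k+1) (y+d) * bernoulliPoly (n+1-(k+1)) y / ((n:ℝ)+1-((k+1:ℕ):ℝ))
      + ∑ k ∈ Finset.range n, bernoulliPoly (k+1) (y+d) * bernoulliPoly (n-k) y / ((k:ℝ)+1) := by
    rw [← Finset.sum_add_distrib]
    apply Finset.sum_congr rfl
    intro k hk
    have hk := Finset.mem_range.1 hk
    have e1 : n + 1 - (k+1) = n - k := by omega
    have e3 : (k:ℝ) < n := by exact_mod_cast hk
    have e4 : (n:ℝ) - k ≠ 0 := by linarith
    have e5 : (k:ℝ) + 1 ≠ 0 := by positivity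
    have e6 : (n:ℝ)+1-((k+1:ℕ):ℝ) = n - k := by push_cast; ring
    rw [e1, e6]
    field_simp
    ring
  rw [this]
  simp [b_zero]
  ring

/-- Second sum. -/
noncomputable def TT (n : ℕ) (x y : ℝ) : ℝ :=
  UU n (fun l => bernoulliPoly (l+1) (x-y) / ((l:ℝ)+1)^2) y
   + UU n (fun l => bernoulliPoly (l+1) (y-x) / ((l:ℝ)+1)^2) x

/-- The difference of both sides. -/
noncomputable def FF (n : ℕ) (x y : ℝ) : ℝ :=
  SS n x y - TT n x y - harm n / ((n:ℝ)+1) * (bernoulliPoly (n+1) x + bernoulliPoly (n+1) y) - QQ n x y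

lemma FF_symm (n : ℕ) (x y : ℝ) : FF n x y = FF n y x := by
  unfold FF TT
  rw [SS_symm, QQ_symm]; ring

lemma FF_deriv (n : ℕ) (d y : ℝ) :
    HasDerivAt (fun y => FF (n+1) (y+d) y) (((n:ℝ)+1) * FF n (y+d) y) y := by
  unfold FF TT QQ
  have e1 : ∀ y : ℝ, y + d - y = d := fun y => by ring
  have e2 : ∀ y : ℝ, y - (y + d) = -d := fun y => by ring
  simp only [e1, e2]
  have h1 := SS_deriv n d y
  have h2 := UU_deriv n (fun l => bernoulliPoly (l+1) d / ((l:ℝ)+1)^2) y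
  have h3 := (UU_deriv n (fun l => bernoulliPoly (l+1) (-d) / ((l:ℝ)+1)^2) (y+d)).comp_add_const y d
  have h4 := UU_deriv n (fun l => d^l / ((l:ℝ)+1)) y
  have h5 := (b_deriv (n+1) (y+d)).comp_add_const y d
  have h6 := b_deriv (n+1) y
  refine (((h1.fun_sub (h2.fun_add h3)).fun_sub ((h5.fun_add h6).const_mul (harm (n+1) / (((n+1:ℕ):ℝ)+1)))).fun_sub h4).congr_deriv ?_
  have : harm (n+1) = harm n + 1/((n:ℝ)+1) := by simp [harm, Finset.sum_range_succ]
  rw [this]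
  have e5 : (n:ℝ) + 1 ≠ 0 := by positivity
  have e6 : (n:ℝ) + 1 + 1 ≠ 0 := by positivity
  push_cast
  field_simp
  ring

lemma b_at_one (k : ℕ) : bernoulliPoly (k+1) 1 = bernoulliPoly (k+1) 0 + if k = 0 then 1 else 0 := by
  have := b_one_add k 0
  rw [add_zero] at this
  rw [this]
  split_ifs with h
  · simp [h]
  · simp [h]

lemma FF_diff (n : ℕ) (y : ℝ) : FF (n+1) 1 y = FF (n+1) 0 y := by
  have hS : SS (n+1) 1 y - SS (n+1) 0 y = bernoulliPoly (n+1) y / ((n:ℝ)+1) := by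
    unfold SS
    rw [← Finset.sum_sub_distrib, Finset.sum_eq_single 0]
    · rw [b_at_one]; simp; ring
    · intro k _ hk
      rw [b_at_one]; simp [hk]
    · simp
  have hT1 : UU (n+1) (fun l => bernoulliPoly (l+1) (1-y) / ((l:ℝ)+1)^2) y
      - UU (n+1) (fun l => bernoulliPoly (l+1) (0-y) / ((l:ℝ)+1)^2) y = QQ (n+1) 0 y := by
    unfold QQ UU
    rw [← Finset.sum_sub_distrib]
    apply Finset.sum_congr rfl
    intro l _
    have := b_one_add l (0-y)
    have e : 1 + (0 - y) = 1 - y := by ring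
    rw [e] at this
    beta_reduce
    rw [this]
    have e5 : (l:ℝ) + 1 ≠ 0 := by positivity
    field_simp
    ring
  have hT2 : UU (n+1) (fun l => bernoulliPoly (l+1) (y-1) / ((l:ℝ)+1)^2) 1
      - UU (n+1) (fun l => bernoulliPoly (l+1) (y-0) / ((l:ℝ)+1)^2) 0
      = - QQ (n+1) y 1 + bernoulliPoly (n+1) y / ((n:ℝ)+1) := by
    have key : bernoulliPoly (n+1) y / ((n:ℝ)+1) = ∑ l ∈ Finset.range (n+1+1),
        ((n+1).choose l : ℝ) * (bernoulliPoly (l+1) y / ((l:ℝ)+1)^2) * (bernoulliPoly (n+1-l) 1 - bernoulliPoly (n+1-l) 0) := by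
      rw [Finset.sum_eq_single n]
      · have e : n + 1 - n = 0 + 1 := by omega
        rw [e, b_at_one]
        have e5 : (n:ℝ) + 1 ≠ 0 := by positivity
        simp
        field_simp
      · intro l hl hln
        have hl := Finset.mem_range.1 hl
        by_cases h : l = n + 1
        · subst h; simp [b_zero]
        · have e : n + 1 - l = (n - l) + 1 := by omega
          have e' : n - l ≠ 0 := by omega
          rw [e, b_at_one]; simp [e']
      · simp
    rw [key]
    unfold QQ UU
    rw [← Finset.sum_sub_distrib, ← Finset.sum_neg_distrib, ← Finset.sum_add_distrib]
    apply Finset.sum_congr rfl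
    intro l _
    have := b_one_add l (y-1)
    have e : 1 + (y - 1) = y := by ring
    rw [e] at this
    beta_reduce
    rw [sub_zero, this]
    have e5 : (l:ℝ) + 1 ≠ 0 := by positivity
    field_simp
    ring
  have hb : bernoulliPoly (n+1+1) 1 = bernoulliPoly (n+1+1) 0 := by rw [b_at_one]; simp
  have hq := QQ_symm (n+1) y 1
  unfold FF TT
  rw [hb]
  linarith

/-- Being a polynomial function. -/
def IsP (f : ℝ → ℝ) : Prop := ∃ p : Polynomial ℝ, ∀ x, f x = p.eval x

lemma IsP.const (c : ℝ) : IsP (fun _ => c) := ⟨Polynomial.C c, by simp⟩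
lemma IsP.id : IsP (fun x => x) := ⟨Polynomial.X, by simp⟩
lemma IsP.add {f g : ℝ → ℝ} (hf : IsP f) (hg : IsP g) : IsP (fun x => f x + g x) := by
  obtain ⟨p, hp⟩ := hf
  obtain ⟨q, hq⟩ := hg
  exact ⟨p + q, by simp [hp, hq]⟩
lemma IsP.mul {f g : ℝ → ℝ} (hf : IsP f) (hg : IsP g) : IsP (fun x => f x * g x) := by
  obtain ⟨p, hp⟩ := hf
  obtain ⟨q, hq⟩ := hg
  exact ⟨p * q, by simp [hp, hq]⟩
lemma IsP.sub {f g : ℝ → ℝ} (hf : IsP f) (hg : IsP g) : IsP (fun x => f x - g x) := by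
  obtain ⟨p, hp⟩ := hf
  obtain ⟨q, hq⟩ := hg
  exact ⟨p - q, by simp [hp, hq]⟩
lemma IsP.pow {f : ℝ → ℝ} (hf : IsP f) (n : ℕ) : IsP (fun x => f x ^ n) := by
  obtain ⟨p, hp⟩ := hf
  exact ⟨p ^ n, by simp [hp]⟩
lemma IsP.div {f : ℝ → ℝ} (hf : IsP f) (c : ℝ) : IsP (fun x => f x / c) := by
  simp only [div_eq_mul_inv]
  exact hf.mul (IsP.const _)
lemma IsP.sum {s : Finset ℕ} {f : ℕ → ℝ → ℝ} (hf : ∀ i, IsP (f i)) : IsP (fun x => ∑ i ∈ s, f i x) := by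
  choose p hp using hf
  exact ⟨∑ i ∈ s, p i, by simp [hp, Polynomial.eval_finsetSum]⟩
lemma IsP.b {f : ℝ → ℝ} (hf : IsP f) (n : ℕ) : IsP (fun x => bernoulliPoly n (f x)) := by
  unfold bernoulliPoly
  exact IsP.sum fun i => (IsP.const _).mul (hf.pow _)
lemma IsP.UU {f : ℝ → ℝ} (hf : IsP f) (n : ℕ) {a : ℕ → ℝ → ℝ} (ha : ∀ i, IsP (a i)) :
    IsP (fun x => UU n (fun l => a l x) (f x)) := by
  unfold _root_.UU
  exact IsP.sum fun i => ((IsP.const _).mul (ha i)).mul (hf.b _)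

lemma FF_isP (n : ℕ) : IsP (fun d => FF n d 0) := by
  unfold FF TT SS QQ
  have h0 := IsP.const 0
  have hi := IsP.id
  refine IsP.sub (IsP.sub (IsP.sub (IsP.sum fun i => ((hi.b _).mul (h0.b _)).div _) (IsP.add ?_ ?_)) ?_) ?_
  · exact h0.UU n fun i => ((hi.sub h0).b _).div _
  · exact hi.UU n fun i => ((h0.sub hi).b _).div _
  · exact (IsP.const _).mul ((hi.b _).add (h0.b _))
  · exact h0.UU n fun i => ((hi.sub h0).pow _).div _

lemma IsP.periodic {f : ℝ → ℝ} (hf : IsP f) (h : ∀ x, f (x+1) = f x) (x : ℝ) : f x = f 0 := by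
  obtain ⟨p, hp⟩ := hf
  have hn : ∀ n : ℕ, f n = f 0 := by
    intro n
    induction n with
    | zero => simp
    | succ n ih => push_cast; rw [h, ih]
  have : p = Polynomial.C (f 0) := by
    apply Polynomial.eq_of_infinite_eval_eq
    apply (Set.infinite_range_of_injective (Nat.cast_injective (R := ℝ))).mono
    rintro _ ⟨n, rfl⟩
    simp [← hp, hn]
  rw [hp x, this]; simp

lemma FF_step (n : ℕ) (c : ℝ) (hc : ∀ x y, FF n x y = c) :
    c = 0 ∧ ∃ c', ∀ x y, FF (n+1) x y = c' := by
  have h1 : ∀ d y, FF (n+1) (y+d) y = FF (n+1) d 0 + ((n:ℝ)+1) * c * y := by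
    intro d y
    have : ∀ z, HasDerivAt (fun y => FF (n+1) (y+d) y - ((n:ℝ)+1) * c * y) 0 z := by
      intro z
      have := (FF_deriv n d z).fun_sub ((hasDerivAt_id z).const_mul (((n:ℝ)+1) * c))
      rw [hc] at this
      simpa using this
    have := const_of_deriv this y 0
    simp at this
    linarith
  have hper : ∀ x, FF (n+1) (x+1) 0 = FF (n+1) x 0 := by
    intro x
    have a := h1 (x+1) (-x)
    have b := h1 x (-x)
    have c := FF_diff n (-x)
    have e1 : -x + (x+1) = 1 := by ring
    have e2 : -x + x = 0 := by ring
    rw [e1] at a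
    rw [e2] at b
    linarith
  have hc0 : c = 0 := by
    have a := h1 (-1) 1
    have e : (1:ℝ) + -1 = 0 := by ring
    rw [e, FF_symm] at a
    have b := hper (-1)
    have b' := hper 0
    have e' : (-1:ℝ) + 1 = 0 := by ring
    rw [e'] at b
    rw [zero_add] at b'
    have : ((n:ℝ)+1) * c = 0 := by linarith
    rcases mul_eq_zero.1 this with h | h
    · exfalso
      have : (n:ℝ) + 1 > 0 := by positivity
      linarith
    · exact h
  refine ⟨hc0, FF (n+1) 0 0, fun x y => ?_⟩
  have a := h1 (x-y) y
  have b := (FF_isP (n+1)).periodic hper (x-y)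
  have e : y + (x - y) = x := by ring
  rw [e, hc0] at a
  linarith

lemma FF_const (n : ℕ) : ∃ c, ∀ x y, FF n x y = c := by
  induction n with
  | zero =>
    refine ⟨0, fun x y => ?_⟩
    simp [FF, SS, TT, UU, QQ, harm, bernoulliPoly, Finset.sum_range_succ]
    ring
  | succ n ih =>
    obtain ⟨c, hc⟩ := ih
    exact (FF_step n c hc).2

lemma FF_zero (n : ℕ) (x y : ℝ) : FF n x y = 0 := by
  obtain ⟨c, hc⟩ := FF_const n
  rw [hc, (FF_step n c hc).1]

theorem stmt_0 (n : ℕ) (hn : 1 < n) (x y : ℝ) (hxy : x ≠ y) :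
    (∑ k ∈ Finset.Icc 1 (n - 1),
        bernoulliPoly k x * bernoulliPoly (n - k) y / ((k : ℝ) * ((n : ℝ) - (k : ℝ)))) -
      (∑ l ∈ Finset.Icc 1 n, ((n - 1).choose (l - 1) : ℝ) *
        (bernoulliPoly l (x - y) * bernoulliPoly (n - l) y +
          bernoulliPoly l (y - x) * bernoulliPoly (n - l) x) / (l : ℝ) ^ 2) =
    harm (n - 1) / (n : ℝ) * (bernoulliPoly n x + bernoulliPoly n y) +
      (bernoulliPoly n x - bernoulliPoly n y) / ((n : ℝ) * (x - y)) := by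
  obtain ⟨m, rfl⟩ : ∃ m, n = m + 1 := ⟨n - 1, by omega⟩
  have hI : ∀ (N : ℕ) (f : ℕ → ℝ), ∑ k ∈ Finset.Icc 1 N, f k = ∑ k ∈ Finset.range N, f (k+1) := by
    intro N f
    rw [Finset.range_eq_Ico, Finset.sum_Ico_add' f 0 N 1]
    rfl
  rw [hI, hI]
  simp only [Nat.add_sub_cancel]
  have hS : ∑ k ∈ Finset.range m, bernoulliPoly (k+1) x * bernoulliPoly (m+1-(k+1)) y /
      (((k+1:ℕ):ℝ) * (((m+1:ℕ):ℝ) - ((k+1:ℕ):ℝ))) = SS m x y := by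
    unfold SS
    apply Finset.sum_congr rfl
    intro k _
    have e : m + 1 - (k+1) = m - k := by omega
    rw [e]
    push_cast
    congr 2
    ring
  have hT : ∑ l ∈ Finset.range (m+1), (m.choose l : ℝ) *
        (bernoulliPoly (l+1) (x - y) * bernoulliPoly (m+1 - (l+1)) y +
          bernoulliPoly (l+1) (y - x) * bernoulliPoly (m+1 - (l+1)) x) / ((l+1:ℕ) : ℝ) ^ 2 = TT m x y := by
    unfold TT UU
    rw [← Finset.sum_add_distrib]
    apply Finset.sum_congr rfl
    intro k _
    have e : m + 1 - (k+1) = m - k := by omega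
    rw [e]
    push_cast
    ring
  rw [hS, hT]
  have h3 : x - y ≠ 0 := sub_ne_zero.2 hxy
  have h4 : (m:ℝ)+1 ≠ 0 := by positivity
  have hQ : (bernoulliPoly (m+1) x - bernoulliPoly (m+1) y) / (((m+1:ℕ) : ℝ) * (x - y)) = QQ m x y := by
    rw [← QQ_mul]
    push_cast
    field_simp
  rw [hQ]
  have := FF_zero m x y
  unfold FF at this
  push_cast
  linarith
end

section
/- Let n ≥ 4 be an integer and set B̄_k = (2^{1-k} − 1) B_k for each k ≥ 0. Then Σ_{k=2}^{n-2} (B̄_k/k) B̄_{n-k} = (n/2) Σ_{k=2}^{n-2} B̄_k B̄_{n-k} / (k(n-k)) = Σ_{k=2}^{n} C(n, k) (B_k/k) B̄_{n-k} + H_{n-1} B̄_n. -/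
open Finset

/-- `B̄_k = (2^{1-k} - 1) B_k`, where `B_k` is the `k`-th Bernoulli number
(convention `B_1 = -1/2`). -/
noncomputable def bernoulliBar (k : ℕ) : ℚ :=
  ((2 : ℚ) ^ ((1 : ℤ) - (k : ℤ)) - 1) * bernoulli k

/-- The `n`-th harmonic number `H_n = ∑_{k=1}^n 1/k` as a rational number. -/
def harmQ (n : ℕ) : ℚ :=
  ∑ k ∈ Finset.range n, (1 : ℚ) / (k + 1)


open Polynomial in
lemma appell_zero (E : ℕ → ℚ[X]) (a : ℕ → ℚ) (ha : ∀ n, a n ≠ 0) (h0 : E 0 = 0)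
    (hd : ∀ n, derivative (E (n+1)) = C (a n) * E n)
    (he : ∀ n, (E (n+2)).eval 1 = (E (n+2)).eval 0) : ∀ n, E n = 0 := by
  intro n
  induction n with
  | zero => exact h0
  | succ n ih =>
    have h1 := hd n
    rw [ih, mul_zero] at h1
    obtain ⟨c, hc⟩ : ∃ c, E (n+1) = C c :=
      ⟨_, eq_C_of_natDegree_eq_zero (derivative_eq_zero.1 h1)⟩
    have h2 := hd (n+1)
    rw [hc, ← C_mul] at h2
    have h3 : derivative (E (n+2) - C (a (n+1) * c) * X) = 0 := by
      rw [derivative_sub, h2]; simp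
    have h4 := eq_C_of_natDegree_eq_zero (derivative_eq_zero.1 h3)
    have h5 := congrArg (eval 1) h4
    have h6 := congrArg (eval 0) h4
    have h7 := he n
    simp only [eval_sub, eval_mul, eval_C, eval_X] at h5 h6
    have : a (n+1) * c = 0 := by linarith
    rcases mul_eq_zero.1 this with h | h
    · exact absurd h (ha _)
    · rw [hc, h, C_0]

open Polynomial in
lemma bern_ends (n : ℕ) : (Polynomial.bernoulli n).eval 1 = (Polynomial.bernoulli n).eval 0 + if n = 1 then 1 else 0 := by
  rw [Polynomial.bernoulli_eval_one, Polynomial.bernoulli_eval_zero]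
  split_ifs with h
  · subst h; norm_num
  · rw [bernoulli_eq_bernoulli'_of_ne_one h]; simp

open Polynomial in
lemma bern_mul (n : ℕ) : (Polynomial.bernoulli n).comp (C (1/2) * X) +
    (Polynomial.bernoulli n).comp (C (1/2) * X + C (1/2)) - C (2 * (1/2)^n) * Polynomial.bernoulli n = 0 := by
  refine appell_zero (fun n => (Polynomial.bernoulli n).comp (C (1/2) * X) +
    (Polynomial.bernoulli n).comp (C (1/2) * X + C (1/2)) - C (2 * (1/2)^n) * Polynomial.bernoulli n)
    (fun n => (n+1)/2) (fun n => by positivity) ?_ ?_ ?_ n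
  · simp; rw [← C_1, ← C_add, ← C_sub]; norm_num
  · intro n
    have h2 : (C (2:ℚ)) * C (1/2) = 1 := by rw [← C_mul]; norm_num
    simp only [derivative_sub, derivative_add, derivative_comp, derivative_mul, derivative_C, derivative_X,
      Polynomial.derivative_bernoulli_add_one, mul_comp, add_comp, natCast_comp, one_comp, pow_succ, C_mul, C_pow, C_add, zero_mul, zero_add, add_zero, mul_one, div_eq_mul_inv, one_mul]
    simp [← C_pow, -map_pow]
    ring
  · intro n
    simp only [eval_sub, eval_add, eval_mul, eval_comp, eval_C, eval_X, mul_one, mul_zero, zero_add]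
    have := bern_ends (n+2)
    rw [if_neg (by omega)] at this
    norm_num at this ⊢
    rw [this]; ring

lemma bar_eq (k : ℕ) : ((2 : ℚ) ^ ((1 : ℤ) - (k : ℤ)) - 1) * bernoulli k = (Polynomial.bernoulli k).eval (1/2) := by
  have := congrArg (Polynomial.eval 0) (bern_mul k)
  simp only [Polynomial.eval_sub, Polynomial.eval_add, Polynomial.eval_mul, Polynomial.eval_comp, Polynomial.eval_C, Polynomial.eval_X, mul_zero, zero_add, Polynomial.bernoulli_eval_zero, Polynomial.eval_zero] at this
  rw [zpow_sub₀ (by norm_num)]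
  simp only [zpow_one, zpow_natCast, div_eq_mul_inv, one_mul, inv_pow] at this ⊢
  linarith

namespace FP
open Polynomial
noncomputable def b (k : ℕ) : ℚ[X] := C ((k:ℚ)⁻¹) * Polynomial.bernoulli k
def g (k : ℕ) : ℚ := if k < 2 then 0 else _root_.bernoulli k / k
noncomputable def S (n : ℕ) : ℚ[X] := ∑ p ∈ antidiagonal n, b p.1 * b p.2
noncomputable def T (n : ℕ) : ℚ[X] := ∑ k ∈ range (n+1), C (n.choose k * g k) * Polynomial.bernoulli (n - k)

lemma b_zero : b 0 = 0 := by simp [b]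
lemma db (k : ℕ) : derivative (b (k+1)) = Polynomial.bernoulli k := by
  rw [b, derivative_mul, derivative_bernoulli_add_one, derivative_C, zero_mul, zero_add, ← mul_assoc]
  have : C (((k+1:ℕ):ℚ)⁻¹) * ((k:ℚ[X])+1) = 1 := by
    have : ((k:ℚ[X])+1) = C ((k+1:ℕ):ℚ) := by simp
    rw [this, ← C_mul, inv_mul_cancel₀ (by positivity), C_1]
  rw [this, one_mul]
lemma B_eq (k : ℕ) : Polynomial.bernoulli k = C (k:ℚ) * b k + if k = 0 then 1 else 0 := by
  split_ifs with h
  · subst h; simp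
  · rw [b, ← mul_assoc, ← C_mul, mul_inv_cancel₀ (by positivity)]; simp

lemma swap (n : ℕ) (f : ℕ → ℕ → ℚ[X]) : ∑ p ∈ antidiagonal n, f p.1 p.2 = ∑ p ∈ antidiagonal n, f p.2 p.1 := by
  rw [← Finset.Nat.sum_antidiagonal_swap]; rfl

lemma dS (n : ℕ) : derivative (S (n+1)) = 2 * ∑ p ∈ antidiagonal n, b p.1 * Polynomial.bernoulli p.2 := by
  have : derivative (S (n+1)) = 2 * ∑ p ∈ antidiagonal (n+1), b p.1 * derivative (b p.2) := by
    rw [S, derivative_sum]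
    simp only [derivative_mul, sum_add_distrib]
    rw [swap (n+1) (fun i j => derivative (b i) * b j), two_mul]
    congr 1
    exact sum_congr rfl fun p _ => mul_comm _ _
  rw [this, Finset.Nat.sum_antidiagonal_succ']
  simp [b_zero, db]

lemma sumbB (n : ℕ) : ∑ p ∈ antidiagonal n, b p.1 * Polynomial.bernoulli p.2 = C ((n:ℚ)/2) * S n + b n := by
  have h1 : ∑ p ∈ antidiagonal n, C (p.2:ℚ) * (b p.1 * b p.2) = ∑ p ∈ antidiagonal n, C (p.1:ℚ) * (b p.1 * b p.2) := by
    rw [swap n (fun i j => C (j:ℚ) * (b i * b j))]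
    exact sum_congr rfl fun p _ => by ring
  have h2 : ∑ p ∈ antidiagonal n, C (p.2:ℚ) * (b p.1 * b p.2) + ∑ p ∈ antidiagonal n, C (p.1:ℚ) * (b p.1 * b p.2) = C (n:ℚ) * S n := by
    rw [← sum_add_distrib, S, mul_sum]
    refine sum_congr rfl fun p hp => ?_
    rw [← mem_antidiagonal.1 hp]; push_cast; rw [C_add]; ring
  have h3 : ∑ p ∈ antidiagonal n, b p.1 * Polynomial.bernoulli p.2 = ∑ p ∈ antidiagonal n, C (p.2:ℚ) * (b p.1 * b p.2) + b n := by
    have : ∑ p ∈ antidiagonal n, b p.1 * (if p.2 = 0 then 1 else 0) = b n := by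
      rw [Finset.sum_eq_single (n, 0)]
      · simp
      · rintro ⟨i, j⟩ hp hne
        have := mem_antidiagonal.1 hp
        have : j ≠ 0 := by rintro rfl; apply hne; simp_all
        simp [this]
      · simp
    rw [← this, ← sum_add_distrib]
    refine sum_congr rfl fun p hp => ?_
    conv_lhs => rw [B_eq p.2]
    ring
  rw [h3]
  congr 1
  have h4 : C ((n:ℚ)/2) = C (1/2) * C (n:ℚ) := by rw [← C_mul]; congr 1; ring
  rw [h4, mul_assoc, ← h2, ← h1, ← two_mul, ← mul_assoc, show (2:ℚ[X]) = C 2 from rfl, ← C_mul]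
  norm_num

lemma dT (n : ℕ) : derivative (T (n+1)) = C ((n+1:ℕ):ℚ) * T n := by
  rw [T, sum_range_succ, T, derivative_add, derivative_sum, mul_sum]
  simp only [tsub_self, Polynomial.bernoulli_zero, mul_one, derivative_C, add_zero]
  refine sum_congr rfl fun k hk => ?_
  have hk : k ≤ n := by simpa [Nat.lt_succ_iff] using hk
  obtain ⟨m, rfl⟩ := Nat.exists_eq_add_of_le hk
  rw [show k + m + 1 - k = m + 1 by omega, show k + m - k = m by omega, derivative_mul, derivative_C, zero_mul, zero_add, derivative_bernoulli_add_one, ← mul_assoc, ← mul_assoc]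
  congr 1
  have : ((m:ℚ[X])+1) = C ((m+1:ℕ):ℚ) := by simp
  rw [this, ← C_mul, ← C_mul]
  congr 1
  have h := Nat.choose_mul_succ_eq (k+m) k
  rw [show k + m + 1 - k = m + 1 by omega] at h
  have h : ((k+m).choose k : ℚ) * ((k+m+1 : ℕ):ℚ) = ((k+m+1).choose k : ℚ) * ((m+1:ℕ):ℚ) := by exact_mod_cast h
  linear_combination (-g k) * h

lemma b_ends (n : ℕ) : (b n).eval 1 = (b n).eval 0 + if n = 1 then 1 else 0 := by
  simp only [b, eval_mul, eval_C, bern_ends]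
  split_ifs with h
  · subst h; norm_num
  · ring

lemma S_ends (n : ℕ) : (S (n+3)).eval 1 = (S (n+3)).eval 0 + 2 * (b (n+2)).eval 0 := by
  have h1 : ∑ p ∈ antidiagonal (n+3), (b p.1).eval 0 * (if p.2 = 1 then 1 else 0) = (b (n+2)).eval 0 := by
    rw [Finset.sum_eq_single (n+2, 1)]
    · simp
    · rintro ⟨i, j⟩ hp hne
      have := mem_antidiagonal.1 hp
      have : j ≠ 1 := by rintro rfl; apply hne; simp at this ⊢; omega
      simp [this]
    · simp
  have h2 : ∑ p ∈ antidiagonal (n+3), (b p.2).eval 0 * (if p.1 = 1 then 1 else 0) = (b (n+2)).eval 0 := by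
    rw [← h1, ← Finset.Nat.sum_antidiagonal_swap]; rfl
  rw [two_mul]
  nth_rewrite 1 [← h1]
  rw [← h2, S, eval_finsetSum, eval_finsetSum, ← sum_add_distrib, ← sum_add_distrib]
  refine sum_congr rfl fun p hp => ?_
  have := mem_antidiagonal.1 hp
  simp only [eval_mul, b_ends]
  split_ifs <;> first | omega | ring

lemma T_ends (n : ℕ) : (T (n+3)).eval 1 = (T (n+3)).eval 0 + (n+3) * (b (n+2)).eval 0 := by
  have h1 : ∑ k ∈ range (n+3+1), ((n+3).choose k * g k) * (if n + 3 - k = 1 then 1 else 0) = (n+3) * (b (n+2)).eval 0 := by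
    rw [Finset.sum_eq_single (n+2)]
    · rw [if_pos (by omega), Nat.choose_succ_self_right]
      simp [b, g, Polynomial.bernoulli_eval_zero]; ring
    · intro k hk hne
      rw [if_neg (by simp at hk; omega), mul_zero]
    · intro h; simp at h
  rw [← h1, T, eval_finsetSum, eval_finsetSum, ← sum_add_distrib]
  refine sum_congr rfl fun p hp => ?_
  simp only [eval_mul, eval_C, bern_ends]
  ring

lemma harm_succ (n : ℕ) : ∑ k ∈ range (n+1), (1 : ℚ) / (k + 1) = ∑ k ∈ range n, (1 : ℚ) / (k + 1) + ((n+1:ℕ):ℚ)⁻¹ := by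
  rw [sum_range_succ]; simp

theorem main (n : ℕ) : C (((n+1:ℕ):ℚ)/2) * S (n+1) - (T (n+1) + C (∑ k ∈ range n, (1 : ℚ) / (k + 1)) * Polynomial.bernoulli (n+1)) = 0 := by
  refine appell_zero (fun n => C (((n+1:ℕ):ℚ)/2) * S (n+1) - (T (n+1) + C (∑ k ∈ range n, (1 : ℚ) / (k + 1)) * Polynomial.bernoulli (n+1)))
    (fun n => ((n+2:ℕ):ℚ)) (fun n => by positivity) ?_ ?_ ?_ n
  · simp [S, T, Finset.Nat.antidiagonal_succ, b_zero, sum_range_succ, g]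
  · intro n
    simp only [derivative_sub, derivative_add, derivative_mul, derivative_C, zero_mul, zero_add, dS, dT, sumbB, derivative_bernoulli_add_one, harm_succ, C_add]
    have h4 : C (((n+1+1:ℕ):ℚ)/2) * 2 = C (((n+2:ℕ):ℚ)) := by
      rw [show (2:ℚ[X]) = C 2 from rfl, ← C_mul]; congr 1; ring
    have h5 : (((n+1:ℕ):ℚ[X])+1) = C (((n+2:ℕ):ℚ)) := by
      rw [show (1:ℚ[X]) = C 1 from rfl, ← C_eq_natCast, ← C_add]; congr 1; push_cast; ring
    rw [← mul_assoc, h4, h5, b]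
    ring
  · intro n
    simp only [eval_sub, eval_add, eval_mul, eval_C, S_ends, T_ends, bern_ends]
    rw [if_neg (by omega)]
    push_cast
    ring
end FP

lemma sum_split (m : ℕ) (f : ℕ → ℚ) (h0 : f 0 = 0) (h1 : f 1 = 0) (h3 : f (m+3) = 0) :
    ∑ k ∈ range (m+4+1), f k = ∑ k ∈ Icc 2 (m+2), f k + f (m+4) := by
  rw [sum_range_succ, sum_range_succ, h3, add_zero, range_eq_Ico,
    sum_eq_sum_Ico_succ_bot (by omega), sum_eq_sum_Ico_succ_bot (by omega), h0, h1, zero_add, zero_add]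
  rfl

lemma bar_eq' (k : ℕ) : (Polynomial.bernoulli k).eval (1/2) = bernoulliBar k := (bar_eq k).symm

lemma bar_one : bernoulliBar 1 = 0 := by simp [bernoulliBar]

theorem stmt_5 (n : ℕ) (hn : 4 ≤ n) :
    (∑ k ∈ Finset.Icc 2 (n - 2), bernoulliBar k / (k : ℚ) * bernoulliBar (n - k)) =
      (n : ℚ) / 2 * (∑ k ∈ Finset.Icc 2 (n - 2),
        bernoulliBar k * bernoulliBar (n - k) / ((k : ℚ) * ((n : ℚ) - (k : ℚ)))) ∧
    ((n : ℚ) / 2 * (∑ k ∈ Finset.Icc 2 (n - 2),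
        bernoulliBar k * bernoulliBar (n - k) / ((k : ℚ) * ((n : ℚ) - (k : ℚ))))) =
      (∑ k ∈ Finset.Icc 2 n, (n.choose k : ℚ) * (bernoulli k / (k : ℚ)) * bernoulliBar (n - k)) +
        harmQ (n - 1) * bernoulliBar n := by
  obtain ⟨m, rfl⟩ := Nat.exists_eq_add_of_le' hn
  rw [show m + 4 - 2 = m + 2 by omega]
  have hS : (FP.S (m+4)).eval (1/2) = ∑ k ∈ Finset.Icc 2 (m+2),
        bernoulliBar k * bernoulliBar (m + 4 - k) / ((k : ℚ) * (((m+4:ℕ) : ℚ) - (k : ℚ))) := by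
    rw [FP.S, Polynomial.eval_finsetSum, Finset.Nat.sum_antidiagonal_eq_sum_range_succ_mk]
    simp only [FP.b, Polynomial.eval_mul, Polynomial.eval_C, bar_eq']
    rw [sum_split m]
    · simp only [tsub_self, Nat.cast_zero, inv_zero, zero_mul, mul_zero, add_zero]
      refine sum_congr rfl fun k hk => ?_
      have := mem_Icc.1 hk
      rw [Nat.cast_sub (by omega), div_eq_mul_inv, mul_inv]
      ring
    · simp
    · simp [bar_one]
    · rw [show m + 4 - (m + 3) = 1 by omega]; simp [bar_one]
  have hB := congrArg (Polynomial.eval (1/2)) (FP.sumbB (m+4))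
  rw [Finset.Nat.sum_antidiagonal_eq_sum_range_succ_mk, Polynomial.eval_finsetSum] at hB
  simp only [FP.b, Polynomial.eval_mul, Polynomial.eval_add, Polynomial.eval_C, bar_eq', hS] at hB
  rw [sum_split m _ (by simp) (by simp [bar_one])
    (by rw [show m + 4 - (m + 3) = 1 by omega]; simp [bar_one])] at hB
  have hb0 : bernoulliBar 0 = 1 := by norm_num [bernoulliBar]
  rw [Nat.sub_self, hb0, mul_one, add_left_inj] at hB
  constructor
  · rw [← hB]
    exact sum_congr rfl fun k _ => by ring
  · have hM := congrArg (Polynomial.eval (1/2)) (FP.main (m+3))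
    simp only [Polynomial.eval_mul, Polynomial.eval_add, Polynomial.eval_sub, Polynomial.eval_C, bar_eq', Polynomial.eval_zero] at hM
    rw [show m + 3 + 1 = m + 4 from rfl, hS] at hM
    have hT : (FP.T (m+4)).eval (1/2) = ∑ k ∈ Finset.Icc 2 (m+4), ((m+4).choose k : ℚ) * (bernoulli k / (k : ℚ)) * bernoulliBar (m + 4 - k) := by
      rw [FP.T, Polynomial.eval_finsetSum, range_eq_Ico,
        sum_eq_sum_Ico_succ_bot (by omega), sum_eq_sum_Ico_succ_bot (by omega)]
      simp only [Polynomial.eval_mul, Polynomial.eval_C, bar_eq']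
      simp only [FP.g, Nat.zero_lt_two, if_true, mul_zero, zero_mul, zero_add, Nat.one_lt_two]
      refine sum_congr rfl fun k hk => ?_
      have hk2 : 2 ≤ k := (mem_Icc.1 hk).1
      rw [if_neg (by omega)]
    rw [hT] at hM
    rw [harmQ, show m + 4 - 1 = m + 3 by omega]
    linarith
end

section
/- (Miki's identity) For every integer n ≥ 4, Σ_{k=2}^{n-2} B_k B_{n-k} / (k(n-k)) − Σ_{l=2}^{n-2} C(n, l) B_l B_{n-l} / (l(n-l)) = (2/n) H_n B_n. -/
open Finset

noncomputable section
def mD : PowerSeries ℚ := PowerSeries.mk fun n => 1 / ((n+1).factorial : ℚ)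

def mbeta (i : ℕ) : ℚ := if i = 0 then 0 else bernoulli' i / (i.factorial : ℚ)

lemma mD_X : PowerSeries.X * mD = PowerSeries.exp ℚ - 1 := by
  ext n
  rcases n with _ | n
  · simp
  · rw [PowerSeries.coeff_succ_X_mul]
    simp [mD, PowerSeries.coeff_exp, PowerSeries.coeff_one]

lemma mD_B : bernoulli'PowerSeries ℚ * mD = PowerSeries.exp ℚ := by
  have h := bernoulli'PowerSeries_mul_exp_sub_one ℚ
  rw [← mD_X] at h
  have : PowerSeries.X * (bernoulli'PowerSeries ℚ * mD) = PowerSeries.X * PowerSeries.exp ℚ := by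
    rw [← h]; ring
  exact mul_left_cancel₀ PowerSeries.X_ne_zero this

lemma mD_der : mD + PowerSeries.X * PowerSeries.derivative ℚ mD = PowerSeries.exp ℚ := by
  have h := congrArg (PowerSeries.derivative ℚ) mD_X
  rw [Derivation.leibniz, map_sub, PowerSeries.derivative_X, PowerSeries.derivative_exp] at h
  simp only [smul_eq_mul, mul_one, Derivation.map_one_eq_zero, sub_zero] at h
  rw [← h]; ring

lemma mbeta_mk : PowerSeries.mk mbeta = bernoulli'PowerSeries ℚ - 1 := by
  ext n
  rcases n with _ | n
  · simp [mbeta, bernoulli'PowerSeries]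
  · simp [mbeta, bernoulli'PowerSeries, PowerSeries.coeff_one]

lemma mD_pow (m : ℕ) : PowerSeries.X * PowerSeries.derivative ℚ (mD ^ m) =
    (m : PowerSeries ℚ) * (PowerSeries.mk mbeta * mD ^ m) := by
  rcases m with _ | m
  · simp
  · rw [Derivation.leibniz_pow, mbeta_mk]
    simp only [smul_eq_mul, nsmul_eq_mul, Nat.add_sub_cancel]
    have h : PowerSeries.X * PowerSeries.derivative ℚ mD = bernoulli'PowerSeries ℚ * mD - mD := by
      rw [mD_B, ← mD_der]; ring
    linear_combination ((m+1 : ℕ) : PowerSeries ℚ) * mD ^ m * h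

lemma mX_der (f : PowerSeries ℚ) (n : ℕ) :
    PowerSeries.coeff n (PowerSeries.X * PowerSeries.derivative ℚ f) = n * PowerSeries.coeff n f := by
  rcases n with _ | n
  · simp
  · rw [PowerSeries.coeff_succ_X_mul, PowerSeries.coeff_derivative]; push_cast; ring

def md (n m : ℕ) : ℚ := PowerSeries.coeff n (mD ^ m)

lemma md_rec (n m : ℕ) : (n : ℚ) * md n m =
    m * ∑ p ∈ antidiagonal n, mbeta p.1 * md p.2 m := by
  have h := congrArg (PowerSeries.coeff n) (mD_pow m)
  rw [mX_der, ← map_natCast (PowerSeries.C (R := ℚ)) m, PowerSeries.coeff_C_mul, PowerSeries.coeff_mul] at h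
  simpa [md] using h

lemma md_step (n m : ℕ) : ((m : ℚ) + 1 + (n + 1)) * md (n+1) (m+1) =
    (m + 1) * (md (n+1) m + md n (m+1)) := by
  have h : PowerSeries.C ((m : ℚ)+1) * mD^(m+1) + PowerSeries.X * PowerSeries.derivative ℚ (mD ^ (m+1)) =
      PowerSeries.C ((m : ℚ)+1) * (mD ^ m + PowerSeries.X * mD ^ (m+1)) := by
    rw [Derivation.leibniz_pow]
    simp only [smul_eq_mul, nsmul_eq_mul, Nat.add_sub_cancel, map_add, map_natCast, map_one]
    push_cast
    linear_combination ((m : PowerSeries ℚ)+1) * mD ^ m * (mD_der - mD_X)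
  have h := congrArg (PowerSeries.coeff (n+1)) h
  rw [map_add, mX_der, PowerSeries.coeff_C_mul, PowerSeries.coeff_C_mul, map_add,
    PowerSeries.coeff_succ_X_mul] at h
  simp only [md]
  push_cast at h
  linear_combination h

lemma md_zero (n : ℕ) : md 0 n = 1 := by
  simp [md, mD]

/-- Stirling-type numbers. -/
def mc (n m : ℕ) : ℚ := md n m * ∏ i ∈ range n, ((m : ℚ) + (i + 1))

lemma mc_step (n m : ℕ) : mc (n+1) (m+1) = mc (n+1) m + (m+1) * mc n (m+1) := by
  have h := md_step n m
  have e : ∏ i ∈ range (n+1), ((m : ℚ) + (i + 1)) = (m+1) * ∏ i ∈ range n, (((m+1 : ℕ) : ℚ) + (i + 1)) := by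
    rw [prod_range_succ', mul_comm]
    congr 1
    · simp
    · apply prod_congr rfl; intros; push_cast; ring
  unfold mc
  rw [e, prod_range_succ]
  push_cast
  linear_combination (∏ i ∈ range n, ((m : ℚ) + 1 + (i + 1))) * h

def mpow (m j : ℕ) : ℚ := if j = 0 then 0 else ∑ i ∈ range m, ((i : ℚ) + 1) ^ j

lemma mA_der (m : ℕ) : PowerSeries.X * PowerSeries.derivative ℚ (PowerSeries.mk fun n => mc n m) =
    PowerSeries.mk (mpow m) * PowerSeries.mk fun n => mc n m := by
  induction m with
  | zero =>
    have h1 : (PowerSeries.mk fun n => mc n 0) = (1 : PowerSeries ℚ) := by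
      ext n
      simp only [mc, md, pow_zero, PowerSeries.coeff_mk, PowerSeries.coeff_one]
      split_ifs with h
      · subst h; simp
      · simp
    have h2 : PowerSeries.mk (mpow 0) = (0 : PowerSeries ℚ) := by
      ext n; simp [mpow]
    rw [h1, h2]; simp
  | succ m ih =>
    set A := PowerSeries.mk fun n => mc n m
    set A' := PowerSeries.mk fun n => mc n (m+1)
    set c : PowerSeries ℚ := PowerSeries.C ((m : ℚ)+1) with hc
    have h1 : A = (1 - c * PowerSeries.X) * A' := by
      ext n
      rw [sub_mul, one_mul, mul_assoc, map_sub, PowerSeries.coeff_C_mul]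
      rcases n with _ | n
      · simp [A, A', mc, md_zero]
      · rw [PowerSeries.coeff_succ_X_mul]
        simp [A, A', mc_step]
    have h2 : (1 - c * PowerSeries.X) * (PowerSeries.mk (mpow (m+1)) - PowerSeries.mk (mpow m)) = c * PowerSeries.X := by
      ext n
      rw [sub_mul, one_mul, mul_assoc, map_sub, PowerSeries.coeff_C_mul, PowerSeries.coeff_C_mul]
      rcases n with _ | n
      · simp [mpow]
      · rw [PowerSeries.coeff_succ_X_mul]
        rcases n with _ | n
        · simp [mpow, sum_range_succ]
        · simp [mpow, sum_range_succ, PowerSeries.coeff_X]; ring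
    have hd : PowerSeries.derivative ℚ A = (1 - c * PowerSeries.X) * PowerSeries.derivative ℚ A' - c * A' := by
      rw [h1, Derivation.leibniz, map_sub, Derivation.leibniz, PowerSeries.derivative_X, hc, PowerSeries.derivative_C]
      simp
      ring
    have hne : (1 - c * PowerSeries.X) ≠ 0 := by
      intro h
      have := congrArg (PowerSeries.coeff 0) h
      simp at this
    apply mul_left_cancel₀ hne
    rw [hd, h1] at ih
    linear_combination ih - A' * h2

lemma mc_rec (n m : ℕ) : (n : ℚ) * mc n m = ∑ p ∈ antidiagonal n, mpow m p.1 * mc p.2 m := by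
  have h := congrArg (PowerSeries.coeff n) (mA_der m)
  rw [mX_der, PowerSeries.coeff_mul] at h
  simpa using h

open Polynomial

lemma mpoly_ext {p q : ℚ[X]} (h : ∀ m : ℕ, p.eval (m : ℚ) = q.eval (m : ℚ)) : p = q := by
  apply Polynomial.eq_of_infinite_eval_eq
  apply Set.Infinite.mono (s := Set.range (fun m : ℕ => (m : ℚ)))
  · rintro _ ⟨m, rfl⟩; exact h m
  · exact Set.infinite_range_of_injective Nat.cast_injective

lemma mb_exists (n : ℕ) : ∃ b : ℚ[X], ∀ m : ℕ, b.eval (m : ℚ) = md n m := by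
  induction n using Nat.strong_induction_on with
  | _ n ih =>
    rcases n with _ | n
    · exact ⟨1, fun m => by simp [md_zero]⟩
    · have : ∀ k : ℕ, ∃ b : ℚ[X], k < n + 1 → ∀ m : ℕ, b.eval (m : ℚ) = md k m := by
        intro k
        by_cases hk : k < n + 1
        · obtain ⟨b, hb⟩ := ih k hk
          exact ⟨b, fun _ => hb⟩
        · exact ⟨0, fun h => absurd h hk⟩
      choose b hb using this
      refine ⟨C (1 / ((n : ℚ)+1)) * (X * ∑ p ∈ antidiagonal (n+1), C (mbeta p.1) * b p.2), fun m => ?_⟩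
      have h := md_rec (n+1) m
      have e : ∑ p ∈ antidiagonal (n+1), mbeta p.1 * md p.2 m =
          ∑ p ∈ antidiagonal (n+1), mbeta p.1 * (b p.2).eval (m : ℚ) := by
        apply sum_congr rfl
        rintro ⟨i, j⟩ hp
        rw [HasAntidiagonal.mem_antidiagonal] at hp
        rcases i with _ | i
        · simp [mbeta]
        · rw [hb j (by simp at hp; omega)]
      rw [e] at h
      simp only [eval_mul, eval_C, eval_X, eval_finsetSum]
      rw [← h]
      push_cast
      field_simp

def mb (n : ℕ) : ℚ[X] := (mb_exists n).choose
lemma mb_eval (n m : ℕ) : (mb n).eval (m : ℚ) = md n m := (mb_exists n).choose_spec m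

lemma mb_zero : mb 0 = 1 := mpoly_ext fun m => by simp [mb_eval, md_zero]

lemma mb_rec (n : ℕ) : C (n : ℚ) * mb n = X * ∑ p ∈ antidiagonal n, C (mbeta p.1) * mb p.2 :=
  mpoly_ext fun m => by simp [eval_finsetSum, mb_eval, md_rec]

def mcp (n : ℕ) : ℚ[X] := mb n * ∏ i ∈ range n, (X + C ((i : ℚ) + 1))

lemma mcp_eval (n m : ℕ) : (mcp n).eval (m : ℚ) = mc n m := by
  simp [mcp, mc, mb_eval, eval_prod]

def mp (j : ℕ) : ℚ[X] := if j = 0 then 0 else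
  ∑ i ∈ range (j+1), C (bernoulli' i * ((j+1).choose i) / ((j:ℚ)+1)) * X ^ (j+1-i)

lemma mp_eval (j m : ℕ) : (mp j).eval (m : ℚ) = mpow m j := by
  unfold mp mpow
  split_ifs with h
  · simp
  · have := sum_Ico_pow m j
    rw [sum_Ico_eq_sum_range] at this
    simp only [Nat.add_sub_cancel] at this
    have e : ∑ i ∈ range m, ((i : ℚ) + 1) ^ j = ∑ k ∈ range m, ((1 + k : ℕ) : ℚ) ^ j := by
      apply sum_congr rfl; intros; push_cast; ring
    rw [e, this, eval_finsetSum]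
    apply sum_congr rfl; intros
    simp; ring

lemma mcp_rec (n : ℕ) : C (n : ℚ) * mcp n = ∑ p ∈ antidiagonal n, mp p.1 * mcp p.2 :=
  mpoly_ext fun m => by simp [eval_finsetSum, mcp_eval, mc_rec, mp_eval]


lemma mp_coeff0 (j : ℕ) : (mp j).coeff 0 = 0 := by
  unfold mp
  split_ifs with h
  · simp
  · rw [finsetSum_coeff]
    apply sum_eq_zero
    intro i hi
    rw [mem_range] at hi
    rw [coeff_C_mul_X_pow, if_neg (by omega)]

lemma mp_coeff1 (j : ℕ) (hj : j ≠ 0) : (mp j).coeff 1 = bernoulli' j := by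
  unfold mp
  rw [if_neg hj, finsetSum_coeff, sum_eq_single j]
  · rw [coeff_C_mul_X_pow, if_pos (by omega)]
    simp
    field_simp
  · intro i hi hne
    rw [mem_range] at hi
    rw [coeff_C_mul_X_pow, if_neg (by omega)]
  · simp

lemma mp_coeff2 (j : ℕ) : (mp (j+1)).coeff 2 = (j+1) * bernoulli' j / 2 := by
  unfold mp
  rw [if_neg (by omega), finsetSum_coeff, sum_eq_single j]
  · rw [coeff_C_mul_X_pow, if_pos (by omega)]
    rw [Nat.choose_symm_of_eq_add (show j + 1 + 1 = j + 2 by omega), Nat.cast_choose_two]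
    push_cast
    field_simp
    ring
  · intro i hi hne
    rw [mem_range] at hi
    rw [coeff_C_mul_X_pow, if_neg (by omega)]
  · intro h; simp at h

lemma mb_coeff0 (n : ℕ) (hn : n ≠ 0) : (mb n).coeff 0 = 0 := by
  have h := congrArg (fun p => p.coeff 0) (mb_rec n)
  simp only [coeff_C_mul, mul_coeff_zero, coeff_X_zero, zero_mul] at h
  simpa [hn] using h

lemma mb_coeff1 (n : ℕ) (hn : n ≠ 0) : n * (mb n).coeff 1 = mbeta n := by
  have h := congrArg (fun p => p.coeff 1) (mb_rec n)
  simp only [coeff_C_mul, coeff_X_mul, finsetSum_coeff] at h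
  rw [h, sum_eq_single (n, 0)]
  · simp [mb_zero]
  · rintro ⟨i, j⟩ hp hne
    rw [HasAntidiagonal.mem_antidiagonal] at hp
    have : j ≠ 0 := by rintro rfl; apply hne; simp at hp; simp [hp]
    simp [mb_coeff0 j this]
  · simp

lemma msum {f g : ℕ → ℚ} (n : ℕ) (hn : 1 ≤ n) (hf : f 0 = 0) (hg : g 0 = 0) :
    ∑ p ∈ antidiagonal n, f p.1 * g p.2 = ∑ k ∈ Icc 1 (n-1), f k * g (n - k) := by
  rw [Nat.sum_antidiagonal_eq_sum_range_succ (fun i j => f i * g j)]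
  symm
  apply sum_subset
  · intro k; simp; omega
  · intro k hk hk'
    simp at hk hk'
    by_cases h0 : k = 0
    · simp [h0, hf]
    · have : n - k = 0 := by omega
      simp [this, hg]

lemma mb_coeff2 (n : ℕ) (hn : 1 ≤ n) : n * (mb n).coeff 2 =
    ∑ k ∈ Icc 1 (n-1), mbeta k * (mb (n-k)).coeff 1 := by
  have h := congrArg (fun p => p.coeff 2) (mb_rec n)
  simp only [coeff_C_mul, coeff_X_mul, finsetSum_coeff] at h
  rw [h, ← msum n hn (f := mbeta) (g := fun j => (mb j).coeff 1)]
  · simp [mbeta]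
  · simp [mb_zero, coeff_one]

lemma mprod_coeff0 (n : ℕ) : (∏ i ∈ range n, (X + C ((i : ℚ) + 1)) : ℚ[X]).coeff 0 = n.factorial := by
  induction n with
  | zero => simp
  | succ n ih => rw [prod_range_succ, mul_coeff_zero, ih, Nat.factorial_succ]; simp; ring

lemma mprod_coeff1 (n : ℕ) : (∏ i ∈ range n, (X + C ((i : ℚ) + 1)) : ℚ[X]).coeff 1 =
    n.factorial * ∑ k ∈ range n, (1 : ℚ) / (k + 1) := by
  induction n with
  | zero => simp [coeff_one]
  | succ n ih =>
    rw [prod_range_succ, mul_add, coeff_add, coeff_mul_X, coeff_mul_C, ih, mprod_coeff0, Nat.factorial_succ,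
      sum_range_succ]
    push_cast
    field_simp
    ring

lemma mcp_zero : mcp 0 = 1 := by simp [mcp, mb_zero]

lemma mcp_coeff0 (n : ℕ) (hn : n ≠ 0) : (mcp n).coeff 0 = 0 := by
  rw [mcp, mul_coeff_zero, mb_coeff0 n hn, zero_mul]

lemma mcp_coeff1 (n : ℕ) (hn : n ≠ 0) : (mcp n).coeff 1 = n.factorial * (mb n).coeff 1 := by
  rw [mcp, coeff_mul, Nat.sum_antidiagonal_eq_sum_range_succ_mk]
  simp only [sum_range_succ, range_zero, sum_empty, mb_coeff0 n hn]
  norm_num only [mprod_coeff0]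
  ring

lemma mcp_coeff2 (n : ℕ) (hn : n ≠ 0) : (mcp n).coeff 2 = n.factorial *
    ((mb n).coeff 2 + (∑ k ∈ range n, (1 : ℚ) / (k + 1)) * (mb n).coeff 1) := by
  rw [mcp, coeff_mul, Nat.sum_antidiagonal_eq_sum_range_succ_mk]
  simp only [sum_range_succ, range_zero, sum_empty, mb_coeff0 n hn]
  norm_num only [mprod_coeff0, mprod_coeff1]
  ring

lemma mcp_coeff2' (n : ℕ) (hn : 1 ≤ n) : n * (mcp n).coeff 2 = (mp n).coeff 2 +
    ∑ k ∈ Icc 1 (n-1), (mp k).coeff 1 * (mcp (n-k)).coeff 1 := by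
  have h := congrArg (fun p => p.coeff 2) (mcp_rec n)
  simp only [coeff_C_mul, finsetSum_coeff] at h
  rw [h, ← msum n hn (f := fun j => (mp j).coeff 1) (g := fun j => (mcp j).coeff 1)
    (by simp [mp]) (by simp [mcp_zero, coeff_one])]
  have e : ∀ p : ℕ × ℕ, (mp p.1 * mcp p.2).coeff 2 = (mp p.1).coeff 1 * (mcp p.2).coeff 1 +
      (mp p.1).coeff 2 * (mcp p.2).coeff 0 := by
    intro p
    rw [coeff_mul, Nat.sum_antidiagonal_eq_sum_range_succ_mk]
    simp [sum_range_succ, mp_coeff0]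
  simp only [e]
  rw [sum_add_distrib, add_comm]
  congr 1
  rw [sum_eq_single (n, 0)]
  · simp [mcp_zero]
  · rintro ⟨i, j⟩ hp hne
    rw [HasAntidiagonal.mem_antidiagonal] at hp
    have : j ≠ 0 := by rintro rfl; apply hne; simp at hp; simp [hp]
    simp [mcp_coeff0 j this]
  · simp

lemma msym (n : ℕ) (f : ℕ → ℚ) (hf : ∀ k, 1 ≤ k → k ≤ n - 1 → f (n-k) = f k) :
    ∑ k ∈ Icc 1 (n-1), f k / ((n : ℚ) - k) = n / 2 * ∑ k ∈ Icc 1 (n-1), f k / (k * ((n : ℚ) - k)) := by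
  have h : ∑ k ∈ Icc 1 (n-1), f k / ((n : ℚ) - k) = ∑ k ∈ Icc 1 (n-1), f k / (k : ℚ) := by
    apply sum_bij' (fun k _ => n - k) (fun k _ => n - k)
    · intro k hk; simp at hk ⊢; omega
    · intro k hk; simp at hk ⊢; omega
    · intro k hk; simp at hk ⊢; omega
    · intro k hk; simp at hk ⊢; omega
    · intro k hk
      simp at hk
      rw [hf k hk.1 hk.2, Nat.cast_sub (by omega)]
  have h2 : ∑ k ∈ Icc 1 (n-1), f k / ((n : ℚ) - k) + ∑ k ∈ Icc 1 (n-1), f k / (k : ℚ) =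
      n * ∑ k ∈ Icc 1 (n-1), f k / (k * ((n : ℚ) - k)) := by
    rw [← sum_add_distrib, mul_sum]
    apply sum_congr rfl
    intro k hk
    simp at hk
    have h1 : (k : ℚ) ≠ 0 := by norm_cast; omega
    have h2 : (n : ℚ) - k ≠ 0 := by
      rw [← Nat.cast_sub (by omega)]; norm_cast; omega
    field_simp
    ring
  linarith

lemma mmain (n : ℕ) (hn : 4 ≤ n) :
    n / 2 * bernoulli' (n-1) + n / 2 * ∑ k ∈ Icc 1 (n-1), bernoulli' k * bernoulli' (n-k) / (k * ((n : ℚ) - k)) =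
    n / 2 * (∑ k ∈ Icc 1 (n-1), (n.choose k : ℚ) * bernoulli' k * bernoulli' (n-k) / (k * ((n : ℚ) - k))) +
    (∑ k ∈ range n, (1 : ℚ) / (k + 1)) * bernoulli' n := by
  rw [← msym n (fun k => bernoulli' k * bernoulli' (n-k)), ← msym n (fun k => (n.choose k : ℚ) * bernoulli' k * bernoulli' (n-k))]
  rotate_left
  · intro k h1 h2
    rw [Nat.sub_sub_self (by omega), Nat.choose_symm (by omega)]; ring
  · intro k h1 h2
    rw [Nat.sub_sub_self (by omega)]; ring
  have hb1 : ∀ j, j ≠ 0 → (mb j).coeff 1 = bernoulli' j / (j.factorial * j) := by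
    intro j hj
    have := mb_coeff1 j hj
    have hj' : (j : ℚ) ≠ 0 := by exact_mod_cast hj
    simp only [mbeta, if_neg hj] at this
    field_simp at this ⊢
    linarith
  have h1 := mcp_coeff2' n (by omega)
  have h2 := mcp_coeff2 n (by omega)
  have h3 := mb_coeff2 n (by omega)
  have h4 := mb_coeff1 n (by omega)
  have h5 : (mp n).coeff 2 = n / 2 * bernoulli' (n-1) := by
    obtain ⟨j, rfl⟩ : ∃ j, n = j + 1 := ⟨n-1, by omega⟩
    rw [mp_coeff2]; simp; ring
  have e1 : ∑ k ∈ Icc 1 (n-1), (mp k).coeff 1 * (mcp (n-k)).coeff 1 =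
      ∑ k ∈ Icc 1 (n-1), bernoulli' k * bernoulli' (n-k) / ((n : ℚ) - k) := by
    apply sum_congr rfl
    intro k hk
    simp at hk
    rw [mp_coeff1 k (by omega), mcp_coeff1 _ (by omega), hb1 _ (by omega), ← Nat.cast_sub (by omega)]
    have : ((n-k : ℕ) : ℚ) ≠ 0 := by norm_cast; omega
    have := Nat.factorial_ne_zero (n-k)
    field_simp
  have e2 : n.factorial * ∑ k ∈ Icc 1 (n-1), mbeta k * (mb (n-k)).coeff 1 =
      ∑ k ∈ Icc 1 (n-1), (n.choose k : ℚ) * bernoulli' k * bernoulli' (n-k) / ((n : ℚ) - k) := by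
    rw [mul_sum]
    apply sum_congr rfl
    intro k hk
    simp at hk
    rw [hb1 _ (by omega), ← Nat.cast_sub (by omega), Nat.cast_choose ℚ (by omega : k ≤ n), mbeta, if_neg (by omega)]
    have : ((n-k : ℕ) : ℚ) ≠ 0 := by norm_cast; omega
    field_simp
  rw [← e1, ← e2, ← h5, ← h1, h2, ← h3]
  have h6 : n.factorial * mbeta n = bernoulli' n := by
    rw [mbeta, if_neg (by omega)]; field_simp
  rw [← h6, ← h4]
  ring

lemma msplit (n : ℕ) (hn : 4 ≤ n) (f : ℕ → ℚ) :
    ∑ k ∈ Icc 1 (n-1), f k = f 1 + f (n-1) + ∑ k ∈ Icc 2 (n-2), f k := by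
  obtain ⟨m, rfl⟩ : ∃ m, n = m + 3 := ⟨n-3, by omega⟩
  rw [← Finset.add_sum_Ioc_eq_sum_Icc (by omega : 1 ≤ m + 3 - 1)]
  rw [show Ioc 1 (m+3-1) = Icc 2 (m+1+1) by ext; simp; omega, Finset.sum_Icc_succ_top (by omega)]
  simp
  ring

end

/-- Miki's identity. `bernoulli` is the `n`-th Bernoulli number. -/
theorem stmt_6 (n : ℕ) (hn : 4 ≤ n) :
    (∑ k ∈ Finset.Icc 2 (n - 2),
        bernoulli k * bernoulli (n - k) / ((k : ℚ) * ((n : ℚ) - (k : ℚ)))) -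
      (∑ l ∈ Finset.Icc 2 (n - 2), (n.choose l : ℚ) *
        bernoulli l * bernoulli (n - l) / ((l : ℚ) * ((n : ℚ) - (l : ℚ)))) =
    2 / (n : ℚ) * harmQ n * bernoulli n := by
  have h := mmain n hn
  rw [msplit n hn, msplit n hn] at h
  have e1 : ∑ k ∈ Finset.Icc 2 (n - 2),
        bernoulli k * bernoulli (n - k) / ((k : ℚ) * ((n : ℚ) - (k : ℚ))) =
      ∑ k ∈ Finset.Icc 2 (n - 2),
        bernoulli' k * bernoulli' (n - k) / ((k : ℚ) * ((n : ℚ) - (k : ℚ))) := by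
    apply sum_congr rfl
    intro k hk
    simp at hk
    rw [bernoulli_eq_bernoulli'_of_ne_one (by omega), bernoulli_eq_bernoulli'_of_ne_one (by omega)]
  have e2 : ∑ l ∈ Finset.Icc 2 (n - 2), (n.choose l : ℚ) *
        bernoulli l * bernoulli (n - l) / ((l : ℚ) * ((n : ℚ) - (l : ℚ))) =
      ∑ l ∈ Finset.Icc 2 (n - 2), (n.choose l : ℚ) *
        bernoulli' l * bernoulli' (n - l) / ((l : ℚ) * ((n : ℚ) - (l : ℚ))) := by
    apply sum_congr rfl
    intro k hk
    simp at hk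
    rw [bernoulli_eq_bernoulli'_of_ne_one (by omega), bernoulli_eq_bernoulli'_of_ne_one (by omega)]
  rw [e1, e2, bernoulli_eq_bernoulli'_of_ne_one (by omega), harmQ]
  have c1 : n.choose (n-1) = n := by
    rw [Nat.choose_symm (by omega)]; simp
  rw [c1, Nat.sub_sub_self (by omega), bernoulli'_one, Nat.choose_one_right, Nat.cast_sub (by omega)] at h
  generalize ∑ k ∈ Finset.Icc 2 (n - 2),
        bernoulli' k * bernoulli' (n - k) / ((k : ℚ) * ((n : ℚ) - (k : ℚ))) = S at *
  generalize ∑ l ∈ Finset.Icc 2 (n - 2), (n.choose l : ℚ) *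
        bernoulli' l * bernoulli' (n - l) / ((l : ℚ) * ((n : ℚ) - (l : ℚ))) = T at *
  generalize ∑ k ∈ range n, (1 : ℚ) / (k + 1) = H at *
  have hn0 : (n : ℚ) ≠ 0 := by norm_cast; omega
  have hn1 : (n : ℚ) - 1 ≠ 0 := by
    rw [sub_ne_zero]; norm_cast; omega
  push_cast at h
  rw [show (n : ℚ) - (n - 1) = 1 by ring] at h
  field_simp at h ⊢
  apply mul_left_cancel₀ hn1
  linear_combination h / 2
end

section
/- (Matiyasevich's first identity) For every integer n ≥ 4, Σ_{k=2}^{n-2} (B_k/k) B_{n-k} − Σ_{l=2}^{n-2} C(n, l) (B_l/l) B_{n-l} = H_n B_n. -/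
open Finset

noncomputable def bc (k : ℕ) : ℝ := (bernoulli k : ℝ) / (k.factorial : ℝ)

theorem ps_key (a b : ℝ) (hab : a + b = 1) (ha : a ≠ 0) (hb : b ≠ 0) :
    PowerSeries.rescale a (bernoulliPowerSeries ℝ) * PowerSeries.rescale b (bernoulliPowerSeries ℝ)
     = bernoulliPowerSeries ℝ * (PowerSeries.C (a*b) * PowerSeries.X
        + PowerSeries.C b * PowerSeries.rescale a (bernoulliPowerSeries ℝ)
        + PowerSeries.C a * PowerSeries.rescale b (bernoulliPowerSeries ℝ)) := by
  have h0 := bernoulliPowerSeries_mul_exp_sub_one ℝ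
  have h1 := congrArg (PowerSeries.rescale a) h0
  have h2 := congrArg (PowerSeries.rescale b) h0
  have h3 := PowerSeries.exp_mul_exp_eq_exp_add (A := ℝ) a b
  rw [hab] at h3
  simp only [map_mul, map_sub, map_one, PowerSeries.rescale_X, PowerSeries.rescale_one, RingHom.id_apply] at h1 h2 h3
  rw [← h3] at h0
  set P := PowerSeries.rescale a (bernoulliPowerSeries ℝ)
  set Q := PowerSeries.rescale b (bernoulliPowerSeries ℝ)
  set R := bernoulliPowerSeries ℝ
  set U := PowerSeries.rescale a (PowerSeries.exp ℝ)
  set V := PowerSeries.rescale b (PowerSeries.exp ℝ)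
  have hX : (PowerSeries.X : PowerSeries ℝ) ≠ 0 := PowerSeries.X_ne_zero
  have hCa : (PowerSeries.C a : PowerSeries ℝ) ≠ 0 := by simpa using ha
  have hCb : (PowerSeries.C b : PowerSeries ℝ) ≠ 0 := by simpa using hb
  have hU : U - 1 ≠ 0 := fun h => by
    rw [h, mul_zero] at h1; exact mul_ne_zero hCa hX h1.symm
  have hV : V - 1 ≠ 0 := fun h => by
    rw [h, mul_zero] at h2; exact mul_ne_zero hCb hX h2.symm
  have hW : U * V - 1 ≠ 0 := fun h => by
    rw [h, mul_zero] at h0; exact hX h0.symm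
  apply mul_right_cancel₀ (mul_ne_zero (mul_ne_zero hU hV) hW)
  rw [map_mul]
  set A := (PowerSeries.C a : PowerSeries ℝ)
  set B := (PowerSeries.C b : PowerSeries ℝ)
  set X := (PowerSeries.X : PowerSeries ℝ)
  calc P * Q * ((U-1)*(V-1)*(U*V-1)) = (P*(U-1))*(Q*(V-1))*(U*V-1) := by ring
    _ = (R*(U*V-1)) * (A*B*X*((U-1)*(V-1)) + B*(P*(U-1))*(V-1) + A*(Q*(V-1))*(U-1)) := by
      rw [h0, h1, h2]; ring
    _ = _ := by ring

theorem coeff_key (a b : ℝ) (hab : a + b = 1) (ha : a ≠ 0) (hb : b ≠ 0) (n : ℕ) :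
    ∑ k ∈ range (n+1), bc k * bc (n-k) * (a^k * b^(n-k))
     = (if n = 0 then 0 else a * b * bc (n-1)) 
        + ∑ k ∈ range (n+1), bc k * bc (n-k) * (b * a^k + a * b^k) := by
  have h := congrArg (PowerSeries.coeff n) (ps_key a b hab ha hb)
  have hc : ∀ k, PowerSeries.coeff k (bernoulliPowerSeries ℝ) = bc k := by
    intro k; simp [bernoulliPowerSeries, bc]
  have e : ∀ c : ℝ, PowerSeries.coeff n (PowerSeries.rescale c (bernoulliPowerSeries ℝ)
      * bernoulliPowerSeries ℝ) = ∑ k ∈ range (n+1), c^k * bc k * bc (n-k) := by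
    intro c
    rw [PowerSeries.coeff_mul, Nat.sum_antidiagonal_eq_sum_range_succ_mk]
    simp only [PowerSeries.coeff_rescale, hc]
  have e0 : PowerSeries.coeff n (bernoulliPowerSeries ℝ * PowerSeries.X) =
      if n = 0 then 0 else bc (n-1) := by
    cases n with
    | zero => simp
    | succ m => simp [PowerSeries.coeff_succ_mul_X, hc]
  rw [show bernoulliPowerSeries ℝ * (PowerSeries.C (a*b) * PowerSeries.X
        + PowerSeries.C b * PowerSeries.rescale a (bernoulliPowerSeries ℝ)
        + PowerSeries.C a * PowerSeries.rescale b (bernoulliPowerSeries ℝ))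
      = PowerSeries.C (a*b) * (bernoulliPowerSeries ℝ * PowerSeries.X)
        + PowerSeries.C b * (PowerSeries.rescale a (bernoulliPowerSeries ℝ) * bernoulliPowerSeries ℝ)
        + PowerSeries.C a * (PowerSeries.rescale b (bernoulliPowerSeries ℝ) * bernoulliPowerSeries ℝ)
      by ring, map_add, map_add, PowerSeries.coeff_C_mul, PowerSeries.coeff_C_mul,
      PowerSeries.coeff_C_mul, e, e, e0, PowerSeries.coeff_mul,
      Nat.sum_antidiagonal_eq_sum_range_succ_mk] at h
  simp only [PowerSeries.coeff_rescale, hc] at h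
  calc _ = ∑ k ∈ range (n+1), a^k * bc k * (b^(n-k) * bc (n-k)) := by
        apply sum_congr rfl; intros; ring
    _ = _ := h
    _ = _ := by
      rw [add_assoc]
      congr 1
      · split_ifs <;> simp
      · rw [mul_sum, mul_sum, ← sum_add_distrib]
        apply sum_congr rfl; intros; ring

theorem beta_int (m : ℕ) : ∀ k : ℕ, ∫ x in (0:ℝ)..1, x^k * (1-x)^m =
    (k.factorial : ℝ) * m.factorial / (k+m+1).factorial := by
  induction m with
  | zero =>
    intro k
    simp [Nat.factorial_succ]
    field_simp
  | succ m ih =>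
    intro k
    have : ∫ x in (0:ℝ)..1, x^k * (1-x)^(m+1) = 
      (∫ x in (0:ℝ)..1, x^k * (1-x)^m) - ∫ x in (0:ℝ)..1, x^(k+1) * (1-x)^m := by
      rw [← intervalIntegral.integral_sub]
      · congr 1; ext x; ring
      · apply Continuous.intervalIntegrable; fun_prop
      · apply Continuous.intervalIntegrable; fun_prop
    rw [this, ih, ih]
    have e1 : k + 1 + m + 1 = (k+m+1)+1 := by ring
    have e2 : k + (m + 1) + 1 = (k+m+1)+1 := by ring
    rw [e1, e2, Nat.factorial_succ (k+m+1), Nat.factorial_succ k, Nat.factorial_succ m]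
    have := Nat.factorial_ne_zero (k+m+1)
    push_cast
    field_simp
    ring

theorem poly_key (n : ℕ) (a : ℝ) (ha : a ≠ 0) (hb : 1 - a ≠ 0) :
    ∑ k ∈ range (n+1), bc (k+1) * bc (n+1-k) * (a^k * (1-a)^(n-k))
     = bc (n+1) + ∑ k ∈ range (n+2), bc (k+1) * bc (n+1-k) * (a^k + (1-a)^k)
       + bc (n+2) * ∑ j ∈ range (n+1), (a^j + (1-a)^j) := by
  have h := coeff_key a (1-a) (by ring) ha hb (n+2)
  have hg1 := geom_sum_mul a (n+1)
  have hg2 := geom_sum_mul (1-a) (n+1)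
  have h0 : bc 0 = 1 := by simp [bc]
  rw [sum_range_succ', sum_range_succ, sum_range_succ' _ (n+2)] at h
  have hs : ∀ x, n+2-(x+1) = n+1-x := by omega
  simp only [hs, h0, Nat.sub_self, Nat.sub_zero, pow_zero] at h
  rw [if_neg (by omega)] at h
  rw [sum_add_distrib]
  have l1 : ∑ k ∈ range (n+1), bc (k+1) * bc (n+1-k) * (a^(k+1) * (1-a)^(n+1-k)) =
    a * (1-a) * ∑ k ∈ range (n+1), bc (k+1) * bc (n+1-k) * (a^k * (1-a)^(n-k)) := by
    rw [mul_sum]; apply sum_congr rfl; intro k hk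
    rw [mem_range] at hk
    rw [show n+1-k = (n-k)+1 by omega]; ring
  have l2 : ∑ k ∈ range (n+2), bc (k+1) * bc (n+1-k) * ((1-a) * a^(k+1) + a * (1-a)^(k+1)) =
    a * (1-a) * ∑ k ∈ range (n+2), bc (k+1) * bc (n+1-k) * (a^k + (1-a)^k) := by
    rw [mul_sum]; apply sum_congr rfl; intro k hk
    ring
  rw [l1, l2] at h
  apply mul_left_cancel₀ (mul_ne_zero ha hb)
  simp only [show n+1+1 = n+2 by rfl] at *
  linear_combination h - bc (n+2) * a * hg1 *(-1) + bc (n+2) * (1-a) * hg2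

theorem int_key (n : ℕ) :
    ∑ k ∈ range (n+1), bc (k+1) * bc (n+1-k) * ((k.factorial : ℝ) * (n-k).factorial / (n+1).factorial)
     = bc (n+1) + ∑ k ∈ range (n+2), bc (k+1) * bc (n+1-k) * (2 / (k+1))
       + bc (n+2) * ∑ j ∈ range (n+1), (2 / ((j:ℝ)+1)) := by
  have hp : ∀ k : ℕ, ∫ x in (0:ℝ)..1, (x^k + (1-x)^k) = 2 / ((k:ℝ)+1) := by
    intro k
    have e1 := beta_int 0 k
    have e2 := beta_int k 0
    simp only [pow_zero, mul_one, one_mul] at e1 e2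
    rw [intervalIntegral.integral_add (Continuous.intervalIntegrable (by fun_prop) _ _)
      (Continuous.intervalIntegrable (by fun_prop) _ _), e1, e2]
    simp [Nat.factorial_succ]
    field_simp
    norm_num
  have h : ∫ a in (0:ℝ)..1, (∑ k ∈ range (n+1), bc (k+1) * bc (n+1-k) * (a^k * (1-a)^(n-k)))
     = ∫ a in (0:ℝ)..1, (bc (n+1) + ∑ k ∈ range (n+2), bc (k+1) * bc (n+1-k) * (a^k + (1-a)^k)
       + bc (n+2) * ∑ j ∈ range (n+1), (a^j + (1-a)^j)) := by
    apply intervalIntegral.integral_congr_ae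
    have : ∀ᵐ x : ℝ, x ≠ 1 := by simp [MeasureTheory.ae_iff]
    filter_upwards [this] with x hx hx2
    simp at hx2
    exact poly_key n x hx2.1.ne' (sub_ne_zero.2 hx.symm)
  rw [intervalIntegral.integral_finsetSum (fun _ _ => Continuous.intervalIntegrable (by fun_prop) _ _),
    intervalIntegral.integral_add (Continuous.intervalIntegrable (by fun_prop) _ _) (Continuous.intervalIntegrable (by fun_prop) _ _),
    intervalIntegral.integral_add (Continuous.intervalIntegrable (by fun_prop) _ _) (Continuous.intervalIntegrable (by fun_prop) _ _),
    intervalIntegral.integral_const_mul,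
    intervalIntegral.integral_finsetSum (fun _ _ => Continuous.intervalIntegrable (by fun_prop) _ _),
    intervalIntegral.integral_finsetSum (fun _ _ => Continuous.intervalIntegrable (by fun_prop) _ _)] at h
  simp only [intervalIntegral.integral_const_mul, hp, beta_int] at h
  simp only [intervalIntegral.integral_const, sub_zero, one_smul] at h
  rw [← h]
  apply sum_congr rfl; intro k hk
  rw [mem_range] at hk
  rw [show k + (n-k) + 1 = n+1 by omega]

theorem main_real (m : ℕ) :
    ∑ k ∈ range (m+3), (bernoulli (k+1) : ℝ) * bernoulli (m+3-k) / (k+1)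
     = (m+4) * bernoulli (m+3) / 2
      + ∑ k ∈ range (m+4), ((m+4).choose (k+1) : ℝ) * (bernoulli (k+1) / (k+1)) * bernoulli (m+3-k)
      + bernoulli (m+4) * ∑ j ∈ range (m+3), (1 / ((j:ℝ)+1)) := by
  have h := congrArg (fun x => ((m+4).factorial : ℝ) * x) (int_key (m+2))
  simp only [mul_add] at h
  have t1 : ((m+4).factorial : ℝ) * ∑ k ∈ range (m+2+1), bc (k+1) * bc (m+2+1-k) * ((k.factorial : ℝ) * (m+2-k).factorial / (m+2+1).factorial)
     = 2 * ∑ k ∈ range (m+3), (bernoulli (k+1) : ℝ) * bernoulli (m+3-k) / (k+1) := by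
    rw [two_mul]
    nth_rw 3 [← sum_range_reflect]
    rw [← sum_add_distrib, mul_sum]
    apply sum_congr rfl
    intro k hk
    rw [mem_range] at hk
    obtain ⟨j, hj⟩ : ∃ j, m + 2 = k + j := ⟨m+2-k, by omega⟩
    rw [show m+2+1-k = j+1 by omega, show m+2-k=j by omega,
      show m+3-1-k = j by omega, show m+3-j = k+1 by omega,
      show m + 2 + 1 = k+j+1 by omega, show m+4 = k+j+1+1 by omega, Nat.factorial_succ (k+j+1)]
    simp only [bc, Nat.factorial_succ k, Nat.factorial_succ j]
    have := Nat.factorial_ne_zero (k+j+1)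
    have := Nat.factorial_ne_zero k
    have := Nat.factorial_ne_zero j
    push_cast
    field_simp
    ring
  have t2 : ((m+4).factorial : ℝ) * bc (m+2+1) = (m+4) * bernoulli (m+3) := by
    rw [Nat.factorial_succ (m+3)]
    have := Nat.factorial_ne_zero (m+3)
    simp only [bc, show m+2+1 = m+3 by rfl]
    push_cast
    field_simp
    ring
  have t3 : ((m+4).factorial : ℝ) * ∑ k ∈ range (m+2+2), bc (k+1) * bc (m+2+1-k) * (2 / (k+1))
    = 2 * ∑ k ∈ range (m+4), ((m+4).choose (k+1) : ℝ) * (bernoulli (k+1) / (k+1)) * bernoulli (m+3-k) := by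
    rw [mul_sum, mul_sum]
    apply sum_congr rfl
    intro k hk
    rw [mem_range] at hk
    rw [Nat.cast_choose ℝ (show k+1 ≤ m+4 by omega), show m+4-(k+1) = m+3-k by omega]
    simp only [bc, show m+2+1 = m+3 by rfl]
    have := Nat.factorial_ne_zero (k+1)
    have := Nat.factorial_ne_zero (m+3-k)
    field_simp
  have t4 : ((m+4).factorial : ℝ) * (bc (m+2+2) * ∑ j ∈ range (m+2+1), (2 / ((j:ℝ)+1)))
    = 2 * (bernoulli (m+4) * ∑ j ∈ range (m+3), (1 / ((j:ℝ)+1))) := by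
    have e : ∀ j : ℕ, 2 / ((j:ℝ)+1) = 2 * (1 / ((j:ℝ)+1)) := by intro j; ring
    simp only [bc, e, ← mul_sum, show m+2+2 = m+4 by rfl, show m+2+1 = m+3 by rfl]
    have := Nat.factorial_ne_zero (m+4)
    field_simp
  rw [t1, t2, t3, t4] at h
  linarith

theorem main_rat (m : ℕ) :
    ∑ k ∈ range (m+3), bernoulli (k+1) * bernoulli (m+3-k) / ((k:ℚ)+1)
     = (m+4) * bernoulli (m+3) / 2
      + ∑ k ∈ range (m+4), ((m+4).choose (k+1) : ℚ) * (bernoulli (k+1) / ((k:ℚ)+1)) * bernoulli (m+3-k)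
      + bernoulli (m+4) * ∑ j ∈ range (m+3), (1 / ((j:ℚ)+1)) := by
  have h := main_real m
  apply Rat.cast_injective (α := ℝ)
  push_cast
  push_cast at h
  exact h

theorem stmt_7 (n : ℕ) (hn : 4 ≤ n) :
    (∑ k ∈ Finset.Icc 2 (n - 2), bernoulli k / (k : ℚ) * bernoulli (n - k)) -
      (∑ l ∈ Finset.Icc 2 (n - 2), (n.choose l : ℚ) * (bernoulli l / (l : ℚ)) * bernoulli (n - l)) =
    harmQ n * bernoulli n := by
  obtain ⟨m, rfl⟩ : ∃ m, n = m + 4 := ⟨n-4, by omega⟩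
  have h := main_rat m
  rw [sum_range_succ, sum_range_succ', sum_range_succ _ (m+3), sum_range_succ _ (m+2),
    sum_range_succ' _ (m+1)] at h
  have hI : ∀ f : ℕ → ℚ, ∑ k ∈ Finset.Icc 2 (m+4-2), f k = ∑ k ∈ range (m+1), f (k+2) := by
    intro f
    rw [← Finset.Ico_add_one_right_eq_Icc, sum_Ico_eq_sum_range, show m+4-2+1-2 = m+1 by omega]
    simp only [add_comm]
  rw [hI, hI]
  have hH : harmQ (m+4) = ∑ j ∈ range (m+3), (1 / ((j:ℚ)+1)) + 1/((m:ℚ)+4) := by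
    rw [harmQ, sum_range_succ]; push_cast; ring
  rw [hH]
  have c1 : ((m+4).choose (m+2+1) : ℚ) = m + 4 := by
    rw [← Nat.choose_symm_of_eq_add (show m+4 = 1 + (m+2+1) by omega)]; simp
  have s1 : ∑ k ∈ range (m+1), bernoulli (k+1+1) * bernoulli (m+3-(k+1)) / (((k+1:ℕ):ℚ)+1)
     = ∑ k ∈ range (m+1), bernoulli (k+2) / ((k+2:ℕ):ℚ) * bernoulli (m+4-(k+2)) := by
    apply sum_congr rfl; intro k hk
    rw [show m+4-(k+2) = m+3-(k+1) by omega]; push_cast; ring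
  have s2 : ∑ k ∈ range (m+1), ((m+4).choose (k+1+1):ℚ) * (bernoulli (k+1+1) / (((k+1:ℕ):ℚ)+1)) * bernoulli (m+3-(k+1))
     = ∑ k ∈ range (m+1), ((m+4).choose (k+2):ℚ) * (bernoulli (k+2) / ((k+2:ℕ):ℚ)) * bernoulli (m+4-(k+2)) := by
    apply sum_congr rfl; intro k hk
    rw [show m+4-(k+2) = m+3-(k+1) by omega]; push_cast; ring
  rw [s1, s2, c1, show m+3-(m+2) = 1 by omega, show m+3-(m+3) = 0 by omega, 
    show m+3+1 = m+4 by rfl, show m+2+1 = m+3 by rfl, show m + 3 - 0 = m+3 by rfl, zero_add,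
    bernoulli_one, bernoulli_zero, Nat.choose_self, Nat.choose_one_right] at h
  generalize ∑ k ∈ range (m+1), bernoulli (k+2) / ((k+2:ℕ):ℚ) * bernoulli (m+4-(k+2)) = S at *
  generalize ∑ k ∈ range (m+1), ((m+4).choose (k+2):ℚ) * (bernoulli (k+2) / ((k+2:ℕ):ℚ)) * bernoulli (m+4-(k+2)) = T at *
  generalize ∑ j ∈ range (m+3), (1 / ((j:ℚ)+1)) = H at *
  push_cast at h
  simp only [zero_add, div_one] at h
  have q3 : (m:ℚ) + 3 ≠ 0 := by positivity
  have q4 : (m:ℚ) + 4 ≠ 0 := by positivity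
  rw [show (m:ℚ)+2+1 = m+3 by ring, show (m:ℚ)+3+1 = m+4 by ring] at h
  field_simp at h ⊢
  apply mul_left_cancel₀ q3
  linear_combination h / 2
end

section
/- (Matiyasevich's second identity) For every integer n ≥ 4, (n+2) Σ_{k=2}^{n-2} B_k B_{n-k} − 2 Σ_{l=2}^{n-2} C(n+2, l) B_l B_{n-l} = n(n+1) B_n. -/
open Finset

lemma aux_const (E : ℕ → Polynomial ℚ) (h0 : Polynomial.derivative (E 0) = 0)
    (hd : ∀ n, Polynomial.derivative (E (n+1)) = Polynomial.C ((n:ℚ)+3) * E n)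
    (he : ∀ n, (E n).eval 1 = (E n).eval 0) (n : ℕ) : E n = 0 := by
  have key : ∀ n, Polynomial.derivative (E n) = 0 → E n = 0 := by
    intro n h
    have h1 := Polynomial.eq_C_of_derivative_eq_zero h
    set c := (E n).coeff 0
    have h2 : Polynomial.derivative (E (n+1) - Polynomial.C (((n:ℚ)+3)*c) * Polynomial.X) = 0 := by
      rw [Polynomial.derivative_sub, hd, h1]
      simp
    have h3 := Polynomial.eq_C_of_derivative_eq_zero h2
    have h4 := congrArg (Polynomial.eval 1) h3
    have h5 := congrArg (Polynomial.eval 0) h3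
    rw [Polynomial.eval_C, Polynomial.eval_sub] at h4 h5
    have h6 : ((n:ℚ)+3)*c = 0 := by
      have := he (n+1)
      simp only [Polynomial.eval_mul, Polynomial.eval_C, Polynomial.eval_X] at h4 h5
      linarith
    have h7 : c = 0 := by
      rcases mul_eq_zero.1 h6 with h | h
      · have : (0:ℚ) ≤ n := n.cast_nonneg
        linarith
      · exact h
    rw [h1, h7, Polynomial.C_0]
  induction n with
  | zero => exact key 0 h0
  | succ n ih => exact key _ (by rw [hd, ih, mul_zero])

noncomputable def auxF (n : ℕ) : Polynomial ℚ :=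
  ∑ k ∈ range (n+1), Polynomial.bernoulli k * Polynomial.bernoulli (n-k)

noncomputable def auxH (n : ℕ) : Polynomial ℚ :=
  ∑ k ∈ range (n+1), Polynomial.C (((n+2).choose k : ℚ) * bernoulli (n-k)) * Polynomial.bernoulli k

lemma auxF_deriv (n : ℕ) :
    Polynomial.derivative (auxF (n+1)) = Polynomial.C ((n:ℚ)+2) * auxF n := by
  unfold auxF
  simp only [Polynomial.derivative_sum, Polynomial.derivative_mul, Polynomial.derivative_bernoulli,
    Finset.sum_add_distrib]
  rw [Finset.sum_range_succ', Finset.sum_range_succ (fun k => Polynomial.bernoulli k * _)]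
  simp only [Nat.cast_zero, zero_mul, add_zero, Nat.sub_self, mul_zero]
  rw [← Finset.sum_add_distrib, Finset.mul_sum]
  refine Finset.sum_congr rfl fun k hk => ?_
  obtain ⟨j, rfl⟩ := Nat.exists_eq_add_of_le (Nat.lt_succ_iff.1 (Finset.mem_range.1 hk))
  rw [show k + j + 1 - (k+1) = j by omega, show k + j + 1 - k = j + 1 by omega,
    show k + j - k = j by omega]
  simp only [Nat.cast_add, Nat.cast_one, map_add, map_natCast, map_ofNat, Nat.add_sub_cancel]
  ring

lemma auxH_deriv (n : ℕ) :
    Polynomial.derivative (auxH (n+1)) = Polynomial.C ((n:ℚ)+3) * auxH n := by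
  unfold auxH
  simp only [Polynomial.derivative_sum, Polynomial.derivative_C_mul, Polynomial.derivative_bernoulli]
  rw [Finset.sum_range_succ']
  simp only [Nat.cast_zero, zero_mul, add_zero, mul_zero]
  rw [Finset.mul_sum]
  refine Finset.sum_congr rfl fun k hk => ?_
  have h : (((n+1+2).choose (k+1) : ℕ) : ℚ) * (k+1) = (n+3) * ((n+2).choose k : ℕ) := by
    have := Nat.add_one_mul_choose_eq (n+2) k
    have h2 : (((n+2+1) * (n+2).choose k : ℕ) : ℚ) = (((n+2+1).choose (k+1) * (k+1) : ℕ) : ℚ) := by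
      rw [this]
    push_cast at h2
    rw [show n+1+2 = n+2+1 by omega]
    linarith
  rw [show n + 1 - (k+1) = n - k by omega, show k+1-1 = k by omega]
  rw [← Polynomial.C_eq_natCast, ← mul_assoc, ← mul_assoc, ← Polynomial.C_mul, ← Polynomial.C_mul]
  congr 2
  push_cast
  linear_combination bernoulli (n-k) * h

lemma aux_one (k : ℕ) : (Polynomial.bernoulli k).eval 1 = bernoulli k + if k = 1 then 1 else 0 := by
  rw [Polynomial.bernoulli_eval_one]
  split_ifs with h
  · subst h; norm_num
  · rw [bernoulli_eq_bernoulli'_of_ne_one h, add_zero]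

noncomputable def auxE (n : ℕ) : Polynomial ℚ :=
  Polynomial.C ((n:ℚ)+2) * auxF n - Polynomial.C 2 * auxH n
    - Polynomial.C ((n+2).choose 3 : ℚ) * Polynomial.bernoulli (n-1)

lemma auxE_deriv (n : ℕ) :
    Polynomial.derivative (auxE (n+1)) = Polynomial.C ((n:ℚ)+3) * auxE n := by
  unfold auxE
  simp only [Polynomial.derivative_sub, Polynomial.derivative_C_mul, auxF_deriv, auxH_deriv,
    Polynomial.derivative_bernoulli]
  have h : (((n+1+2).choose 3 : ℕ) : ℚ) * (n : ℚ) = (n+3) * ((n+2).choose 3 : ℕ) := by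
    have h2 := Nat.choose_mul_succ_eq (n+2) 3
    rw [show n+2+1-3 = n by omega] at h2
    have h3 := congrArg (Nat.cast : ℕ → ℚ) h2
    push_cast at h3
    rw [show n+1+2 = n+2+1 by omega]
    linarith
  have h' := congrArg (Polynomial.C : ℚ → Polynomial ℚ) h
  simp only [Polynomial.C_mul, Polynomial.C_add, Polynomial.C_eq_natCast, Nat.cast_add, Nat.cast_one, map_natCast, map_ofNat, Polynomial.C_1, Nat.add_sub_cancel] at h' ⊢
  linear_combination (-Polynomial.bernoulli (n-1)) * h'

lemma auxE_eval (n : ℕ) : (auxE n).eval 1 = (auxE n).eval 0 := by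
  match n with
  | 0 => simp [auxE, auxF, auxH]
  | 1 => simp [auxE, auxF, auxH, Finset.sum_range_succ]; norm_num
  | 2 => simp [auxE, auxF, auxH, Finset.sum_range_succ, Polynomial.bernoulli_eval_zero, Polynomial.bernoulli_eval_one, Nat.choose]; norm_num
  | m+3 =>
    have hF : (auxF (m+3)).eval 1 = (auxF (m+3)).eval 0 + 2 * bernoulli (m+2) := by
      simp only [auxF, Polynomial.eval_finsetSum, Polynomial.eval_mul, aux_one,
        Polynomial.bernoulli_eval_zero]
      have : ∀ k ∈ range (m+3+1), (bernoulli k + if k = 1 then 1 else 0) *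
          (bernoulli (m+3-k) + if m+3-k = 1 then 1 else 0) = bernoulli k * bernoulli (m+3-k)
          + ((if k = 1 then bernoulli (m+2) else 0) + (if k = m+2 then bernoulli (m+2) else 0)) := by
        intro k hk
        have := Finset.mem_range.1 hk
        by_cases h1 : k = 1
        · subst h1
          simp [show m+3-1 = m+2 by omega]
          ring
        · by_cases h2 : k = m+2
          · subst h2
            simp [show m+3-(m+2) = 1 by omega]
            ring
          · simp [h1, h2, show m+3-k ≠ 1 by omega]
      rw [Finset.sum_congr rfl this, Finset.sum_add_distrib, Finset.sum_add_distrib,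
        Finset.sum_ite_eq', Finset.sum_ite_eq']
      simp
      ring
    have hH : (auxH (m+3)).eval 1 = (auxH (m+3)).eval 0 + (m+5) * bernoulli (m+2) := by
      simp only [auxH, Polynomial.eval_finsetSum, Polynomial.eval_mul, aux_one,
        Polynomial.bernoulli_eval_zero, Polynomial.eval_C, mul_add, Finset.sum_add_distrib,
        mul_ite, mul_one, mul_zero, Finset.sum_ite_eq']
      simp
      left
      ring
    simp only [auxE, Polynomial.eval_sub, Polynomial.eval_mul, Polynomial.eval_C, hF, hH, aux_one,
      Polynomial.bernoulli_eval_zero]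
    simp
    ring

/-- Matiyasevich's second identity. `bernoulli` is the `n`-th Bernoulli number. -/
theorem stmt_8 (n : ℕ) (hn : 4 ≤ n) :
    ((n : ℚ) + 2) * (∑ k ∈ Finset.Icc 2 (n - 2), bernoulli k * bernoulli (n - k)) -
      2 * (∑ l ∈ Finset.Icc 2 (n - 2), ((n + 2).choose l : ℚ) * bernoulli l * bernoulli (n - l)) =
    (n : ℚ) * ((n : ℚ) + 1) * bernoulli n := by
  have h := congrArg (Polynomial.eval 0)
    (aux_const auxE (by simp [auxE, auxF, auxH]) auxE_deriv auxE_eval n)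
  obtain ⟨m, rfl⟩ := Nat.exists_eq_add_of_le hn
  have key : ∀ f : ℕ → ℚ, ∑ k ∈ range (4+m+1), f k =
      f 0 + f 1 + ∑ k ∈ Finset.Icc 2 (4+m-2), f k + f (m+3) + f (m+4) := by
    intro f
    rw [show 4+m+1 = m+3+1+1 by omega, Finset.sum_range_succ, Finset.sum_range_succ,
      show Finset.Icc 2 (4+m-2) = Finset.Ico 2 (m+3) by ext; simp; omega,
      Finset.range_eq_Ico, Finset.sum_eq_sum_Ico_succ_bot (by omega),
      Finset.sum_eq_sum_Ico_succ_bot (by omega)]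
    ring
  simp only [auxE, auxF, auxH, Polynomial.eval_sub, Polynomial.eval_mul, Polynomial.eval_C,
    Polynomial.eval_finsetSum, Polynomial.bernoulli_eval_zero, key, Polynomial.eval_zero] at h
  have e1 : (4+m+2).choose (m+3) = (4+m+2).choose 3 :=
    Nat.choose_symm_of_eq_add (by omega)
  have e2 : (4+m+2).choose (m+4) = (4+m+2).choose 2 :=
    Nat.choose_symm_of_eq_add (by omega)
  rw [e1, e2, show 4+m-0 = m+4 by omega, show 4+m-1 = m+3 by omega, show 4+m-(m+3) = 1 by omega,
    show 4+m-(m+4) = 0 by omega, Nat.cast_choose_two, bernoulli_one, bernoulli_zero] at h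
  have e3 : ∑ l ∈ Finset.Icc 2 (4+m - 2), ((4+m + 2).choose l : ℚ) * bernoulli l * bernoulli (4+m - l)
    = ∑ l ∈ Finset.Icc 2 (4+m - 2), ((4+m + 2).choose l : ℚ) * bernoulli (4+m - l) * bernoulli l :=
    Finset.sum_congr rfl fun _ _ => by ring
  rw [e3, show bernoulli (4+m) = bernoulli (m+4) by rw [add_comm]]
  simp only [Nat.choose_zero_right, Nat.choose_one_right] at h
  push_cast at h ⊢
  linear_combination h
end
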